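/- Suppose Q satisfies the HSM inequality Q(u) ≥ (∫_Ω W|u|^{2*} dx)^{2/2*} for all u ∈ C_0^∞(Ω) with a positive continuous weight W, and let Ṽ ∈ L^∞_loc(Ω) be a nonzero potential satisfying |Ṽ|^{N/2} W^{(2−N)/2} ∈ L¹(Ω). If for some λ ∈ ℝ the functional Q̃_λ(u) = Q(u) + λ∫_Ω Ṽ|u|² dx is nonnegative on C_0^∞(Ω) and does not admit a ground state, then there exists a constant C > 0 such that Q̃_λ(u) ≥ C(∫_Ω W|u|^{2*} dx)^{2/2*} for all u ∈ C_0^∞(Ω). -/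

import Mathlib

open MeasureTheory Filter Topology

noncomputable section

abbrev Euc (N : ℕ) := EuclideanSpace ℝ (Fin N)

/-- `u` is a test function on `Ω`, i.e. `u ∈ C_0^∞(Ω)`. -/
def TestFun {N : ℕ} (Ω : Set (Euc N)) (u : Euc N → ℝ) : Prop :=
  ContDiff ℝ (⊤ : ℕ∞) u ∧ HasCompactSupport u ∧ tsupport u ⊆ Ω

/-- `V ∈ L^∞_loc(Ω)`: `V` is bounded on every compact subset of `Ω`. -/
def LocBdd {N : ℕ} (Ω : Set (Euc N)) (V : Euc N → ℝ) : Prop :=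
  ∀ K : Set (Euc N), IsCompact K → K ⊆ Ω → ∃ C : ℝ, ∀ x ∈ K, |V x| ≤ C

/-- The functional `Q(u) = ∫_Ω (|∇u|^p + V|u|^p) dx`. -/
def Qfun {N : ℕ} (Ω : Set (Euc N)) (V : Euc N → ℝ) (p : ℝ) (u : Euc N → ℝ) : ℝ :=
  ∫ x in Ω, (‖gradient u x‖ ^ p + V x * |u x| ^ p)

/-- The critical Sobolev exponent `p* = pN/(N-p)`. -/
def pStar (p : ℝ) (N : ℕ) : ℝ := p * N / (N - p)

/-- `φ ∈ C¹(Ω)` is a ground state of the functional `Q`: it is an `L^p_loc(Ω)`-limit of a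
null sequence, i.e. a sequence of nonnegative test functions `φk` with `Q(φk) → 0` and
`∫_B |φk|^p dx = 1` for some fixed open set `B` compactly contained in `Ω`. -/
def IsGroundState {N : ℕ} (Ω : Set (Euc N)) (V : Euc N → ℝ) (p : ℝ) (φ : Euc N → ℝ) : Prop :=
  ContDiffOn ℝ 1 φ Ω ∧
  ∃ (φk : ℕ → Euc N → ℝ) (B : Set (Euc N)),
    IsOpen B ∧ B.Nonempty ∧ IsCompact (closure B) ∧ closure B ⊆ Ω ∧
    (∀ k, TestFun Ω (φk k) ∧ ∀ x, 0 ≤ φk k x) ∧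
    Tendsto (fun k => Qfun Ω V p (φk k)) atTop (𝓝 0) ∧
    (∀ k, ∫ x in B, |φk k x| ^ p = 1) ∧
    (∀ K : Set (Euc N), IsCompact K → K ⊆ Ω →
      Tendsto (fun k => ∫ x in K, |φk k x - φ x| ^ p) atTop (𝓝 0))

/-- Smooth cutoffs and algebra of test functions. -/
theorem TestFun.add {N : ℕ} {Ω : Set (Euc N)} {u v : Euc N → ℝ}
    (hu : TestFun Ω u) (hv : TestFun Ω v) : TestFun Ω (fun x => u x + v x) := by
  refine ⟨hu.1.add hv.1, hu.2.1.add hv.2.1, ?_⟩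
  exact (tsupport_add u v).trans (Set.union_subset hu.2.2 hv.2.2)

theorem TestFun.mul_smooth {N : ℕ} {Ω : Set (Euc N)} {u g : Euc N → ℝ}
    (hg : ContDiff ℝ (⊤ : ℕ∞) g) (hu : TestFun Ω u) : TestFun Ω (fun x => g x * u x) := by
  refine ⟨hg.mul hu.1, hu.2.1.mul_left, ?_⟩
  exact (tsupport_mul_subset_right (f := g) (g := u)).trans hu.2.2

theorem TestFun.const_mul {N : ℕ} {Ω : Set (Euc N)} {u : Euc N → ℝ}
    (c : ℝ) (hu : TestFun Ω u) : TestFun Ω (fun x => c * u x) :=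
  TestFun.mul_smooth (g := fun _ => c) contDiff_const hu

theorem TestFun.diff {N : ℕ} {Ω : Set (Euc N)} {u : Euc N → ℝ} (hu : TestFun Ω u) :
    Differentiable ℝ u := hu.1.differentiable (by simp)

theorem TestFun.cont {N : ℕ} {Ω : Set (Euc N)} {u : Euc N → ℝ} (hu : TestFun Ω u) :
    Continuous u := hu.1.continuous

theorem grad_add {N : ℕ} {u v : Euc N → ℝ} {x : Euc N} (hu : DifferentiableAt ℝ u x)
    (hv : DifferentiableAt ℝ v x) :
    gradient (fun y => u y + v y) x = gradient u x + gradient v x := by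
  unfold gradient
  rw [fderiv_fun_add hu hv, map_add]

theorem grad_mul {N : ℕ} {u v : Euc N → ℝ} {x : Euc N} (hu : DifferentiableAt ℝ u x)
    (hv : DifferentiableAt ℝ v x) :
    gradient (fun y => u y * v y) x = u x • gradient v x + v x • gradient u x := by
  unfold gradient
  rw [fderiv_fun_mul hu hv, map_add]
  simp

theorem grad_const_mul {N : ℕ} {v : Euc N → ℝ} {x : Euc N} (c : ℝ)
    (hv : DifferentiableAt ℝ v x) :
    gradient (fun y => c * v y) x = c • gradient v x := by
  rw [grad_mul (u := fun _ => c) (by fun_prop) hv]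
  simp [gradient_fun_const]

theorem TestFun.grad_cont {N : ℕ} {Ω : Set (Euc N)} {u : Euc N → ℝ} (hu : TestFun Ω u) :
    Continuous (gradient u) := by
  unfold gradient
  exact (LinearIsometryEquiv.continuous _).comp (hu.1.continuous_fderiv (by simp))

theorem grad_tsupport {N : ℕ} {u : Euc N → ℝ} {x : Euc N} (hx : x ∉ tsupport u) :
    gradient u x = 0 := by
  have : u =ᶠ[𝓝 x] fun _ => 0 := notMem_tsupport_iff_eventuallyEq.1 hx
  rw [this.gradient_eq, gradient_fun_const]

/-- functions vanishing off a compact subset -/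
theorem integrableOn_of_zero_off {N : ℕ} {Ω K : Set (Euc N)} {f : Euc N → ℝ}
    (_ : IsCompact K) (_ : K ⊆ Ω) (hf : IntegrableOn f K)
    (h0 : ∀ x, x ∉ K → f x = 0) : IntegrableOn f Ω := by
  have : Integrable f := by
    rw [← integrableOn_iff_integrable_of_support_subset (s := K)]
    · exact hf
    · intro x hx; by_contra h; exact hx (h0 x h)
  exact this.integrableOn

theorem locBdd_mul_integrable {N : ℕ} {Ω K : Set (Euc N)} {U h : Euc N → ℝ}
    (hU : LocBdd Ω U) (hUm : AEStronglyMeasurable U (volume.restrict Ω))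
    (hK : IsCompact K) (hKΩ : K ⊆ Ω) (hh : ContinuousOn h K) (h0 : ∀ x, x ∉ K → h x = 0) :
    IntegrableOn (fun x => U x * h x) Ω := by
  refine integrableOn_of_zero_off hK hKΩ ?_ (fun x hx => by simp [h0 x hx])
  obtain ⟨C, hC⟩ := hU K hK hKΩ
  have h1 : IntegrableOn h K := hh.integrableOn_compact hK
  refine Integrable.bdd_mul (c := C) h1 (hUm.mono_measure (Measure.restrict_mono hKΩ le_rfl)) ?_
  exact (ae_restrict_mem hK.measurableSet).mono (fun x hx => by simpa using hC x hx)

/-- the bilinear form of `Q` -/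
def QB {N : ℕ} (Ω : Set (Euc N)) (U : Euc N → ℝ) (u v : Euc N → ℝ) : ℝ :=
  ∫ x in Ω, (inner ℝ (gradient u x) (gradient v x) + U x * (u x * v x))

theorem Qfun_eq_QB {N : ℕ} (Ω : Set (Euc N)) (U : Euc N → ℝ) (u : Euc N → ℝ) :
    Qfun Ω U 2 u = QB Ω U u u := by
  unfold Qfun QB
  congr 1; ext x
  rw [real_inner_self_eq_norm_sq, Real.rpow_two, Real.rpow_two, sq_abs, sq (u x)]

theorem grad_inner_integrable {N : ℕ} {Ω : Set (Euc N)} {u v : Euc N → ℝ}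
    (hu : TestFun Ω u) (hv : TestFun Ω v) :
    IntegrableOn (fun x => inner ℝ (gradient u x) (gradient v x)) Ω := by
  refine integrableOn_of_zero_off hu.2.1 hu.2.2 ?_ (fun x hx => by simp [grad_tsupport hx])
  exact (hu.grad_cont.inner hv.grad_cont).continuousOn.integrableOn_compact hu.2.1

theorem pot_integrable {N : ℕ} {Ω : Set (Euc N)} {U u v : Euc N → ℝ}
    (hU : LocBdd Ω U) (hUm : AEStronglyMeasurable U (volume.restrict Ω))
    (hu : TestFun Ω u) (hv : Continuous v) :
    IntegrableOn (fun x => U x * (u x * v x)) Ω := by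
  refine locBdd_mul_integrable hU hUm hu.2.1 hu.2.2 (hu.cont.mul hv).continuousOn ?_
  intro x hx
  simp [image_eq_zero_of_notMem_tsupport hx]

theorem QB_integrable {N : ℕ} {Ω : Set (Euc N)} {U u v : Euc N → ℝ}
    (hU : LocBdd Ω U) (hUm : AEStronglyMeasurable U (volume.restrict Ω))
    (hu : TestFun Ω u) (hv : TestFun Ω v) :
    IntegrableOn (fun x => inner ℝ (gradient u x) (gradient v x) + U x * (u x * v x)) Ω :=
  (grad_inner_integrable hu hv).add (pot_integrable hU hUm hu hv.cont)

theorem QB_eq {N : ℕ} {Ω : Set (Euc N)} {U u v : Euc N → ℝ}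
    (hU : LocBdd Ω U) (hUm : AEStronglyMeasurable U (volume.restrict Ω))
    (hu : TestFun Ω u) (hv : TestFun Ω v) :
    QB Ω U u v = (∫ x in Ω, inner ℝ (gradient u x) (gradient v x)) +
      ∫ x in Ω, U x * (u x * v x) :=
  integral_add (grad_inner_integrable hu hv) (pot_integrable hU hUm hu hv.cont)

theorem QB_add_smul {N : ℕ} {Ω : Set (Euc N)} {U u v : Euc N → ℝ}
    (hU : LocBdd Ω U) (hUm : AEStronglyMeasurable U (volume.restrict Ω))
    (hu : TestFun Ω u) (hv : TestFun Ω v) (a : ℝ) :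
    QB Ω U (fun x => u x + a * v x) (fun x => u x + a * v x) =
      QB Ω U u u + 2 * a * QB Ω U u v + a ^ 2 * QB Ω U v v := by
  unfold QB
  rw [← integral_const_mul, ← integral_const_mul, ← integral_add, ← integral_add]
  · congr 1; ext x
    rw [grad_add (hu.diff x) ((hv.const_mul a).diff x), grad_const_mul a (hv.diff x)]
    simp only [inner_add_left, inner_add_right, inner_smul_left, inner_smul_right]
    rw [real_inner_comm (gradient u x) (gradient v x)]
    simp
    ring
  · exact (QB_integrable hU hUm hu hu).add ((QB_integrable hU hUm hu hv).const_mul _)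
  · exact (QB_integrable hU hUm hv hv).const_mul _
  · exact QB_integrable hU hUm hu hu
  · exact (QB_integrable hU hUm hu hv).const_mul _

theorem QB_amgm {N : ℕ} {Ω : Set (Euc N)} {U u v : Euc N → ℝ}
    (hU : LocBdd Ω U) (hUm : AEStronglyMeasurable U (volume.restrict Ω))
    (hpos : ∀ u : Euc N → ℝ, TestFun Ω u → 0 ≤ QB Ω U u u)
    (hu : TestFun Ω u) (hv : TestFun Ω v) {a : ℝ} (ha : 0 < a) :
    |QB Ω U u v| ≤ (a * QB Ω U u u + a⁻¹ * QB Ω U v v) / 2 := by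
  have h1 := hpos _ (hu.add (hv.const_mul a⁻¹))
  have h2 := hpos _ (hu.add (hv.const_mul (-a⁻¹)))
  rw [QB_add_smul hU hUm hu hv] at h1 h2
  have e : a * a⁻¹ = 1 := mul_inv_cancel₀ ha.ne'
  have h1' := mul_nonneg ha.le h1
  have h2' := mul_nonneg ha.le h2
  have e1 : a * (QB Ω U u u + 2 * a⁻¹ * QB Ω U u v + a⁻¹ ^ 2 * QB Ω U v v) =
    a * QB Ω U u u + 2 * QB Ω U u v + a⁻¹ * QB Ω U v v := by
    field_simp
  have e2 : a * (QB Ω U u u + 2 * -a⁻¹ * QB Ω U u v + (-a⁻¹) ^ 2 * QB Ω U v v) =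
    a * QB Ω U u u - 2 * QB Ω U u v + a⁻¹ * QB Ω U v v := by
    field_simp
    ring
  rw [e1] at h1'
  rw [e2] at h2'
  rw [abs_le]; constructor <;> linarith

theorem QB_cs {N : ℕ} {Ω : Set (Euc N)} {U u v : Euc N → ℝ}
    (hU : LocBdd Ω U) (hUm : AEStronglyMeasurable U (volume.restrict Ω))
    (hpos : ∀ u : Euc N → ℝ, TestFun Ω u → 0 ≤ QB Ω U u u)
    (hu : TestFun Ω u) (hv : TestFun Ω v) :
    |QB Ω U u v| ≤ √(QB Ω U u u) * √(QB Ω U v v) := by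
  have h : ∀ a : ℝ, 0 ≤ QB Ω U v v * (a * a) + (2 * QB Ω U u v) * a + QB Ω U u u := by
    intro a
    have := hpos _ (hu.add (hv.const_mul a))
    rw [QB_add_smul hU hUm hu hv] at this
    linarith
  have := discrim_le_zero h
  unfold discrim at this
  rw [← Real.sqrt_mul (hpos u hu)]
  apply Real.abs_le_sqrt
  linarith

/-- cutoff functions -/
theorem exists_cutoff {N : ℕ} {Ω K : Set (Euc N)} (hΩ : IsOpen Ω) (hK : IsCompact K)
    (hKΩ : K ⊆ Ω) : ∃ η : Euc N → ℝ, TestFun Ω η ∧ (∀ x ∈ K, η x = 1) ∧ (∀ x, 0 ≤ η x) ∧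
      ∀ x, η x ≤ 1 := by
  obtain ⟨K', hK', hKK', hK'Ω⟩ := exists_compact_between hK hΩ hKΩ
  obtain ⟨f, hf1, hf2, hf3, hf4⟩ := exists_contMDiff_support_eq_eq_one_iff
    (modelWithCornersSelf ℝ (Euc N)) (n := (⊤ : ℕ∞)) (s := interior K') (t := K) isOpen_interior hK.isClosed hKK'
  have hts : tsupport f ⊆ K' := by
    rw [tsupport, hf3]
    exact closure_minimal interior_subset hK'.isClosed
  refine ⟨f, ⟨hf1.contDiff, hK'.of_isClosed_subset (isClosed_tsupport f) hts,
    hts.trans hK'Ω⟩, fun x hx => (hf4 x).1 hx, fun x => ?_, fun x => ?_⟩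
  · exact (hf2 (Set.mem_range_self x)).1
  · exact (hf2 (Set.mem_range_self x)).2

theorem weight_bound {N : ℕ} {Ω K : Set (Euc N)} {m c : Euc N → ℝ}
    (hm : ContinuousOn m Ω) (hmpos : ∀ x ∈ Ω, 0 < m x) (hK : IsCompact K) (hKΩ : K ⊆ Ω)
    {C : ℝ} (hC : ∀ x ∈ K, |c x| ≤ C) (h0 : ∀ x, x ∉ K → c x = 0) :
    ∃ D : ℝ, 0 ≤ D ∧ ∀ x ∈ Ω, |c x| ≤ D * m x := by
  rcases K.eq_empty_or_nonempty with rfl | hne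
  · exact ⟨0, le_rfl, fun x _ => by simp [h0 x (by simp)]⟩
  · obtain ⟨x0, hx0, hmin⟩ := hK.exists_isMinOn hne (hm.mono hKΩ)
    have hp := hmpos x0 (hKΩ hx0)
    have hC0 : 0 ≤ C := (abs_nonneg _).trans (hC x0 hx0)
    refine ⟨C / m x0, by positivity, fun x hx => ?_⟩
    by_cases hxK : x ∈ K
    · have h1 : m x0 ≤ m x := hmin hxK
      calc |c x| ≤ C := hC x hxK
        _ = C / m x0 * m x0 := by field_simp
        _ ≤ C / m x0 * m x := by gcongr
    · rw [h0 x hxK, abs_zero]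
      have := hmpos x hx
      positivity

theorem cont_integrable {N : ℕ} {Ω : Set (Euc N)} {m u v : Euc N → ℝ}
    (hm : ContinuousOn m Ω) (hu : TestFun Ω u) (hv : Continuous v) :
    IntegrableOn (fun x => m x * (u x * v x)) Ω := by
  refine integrableOn_of_zero_off hu.2.1 hu.2.2 ?_ (fun x hx => by
    simp [image_eq_zero_of_notMem_tsupport hx])
  exact ((hm.mono hu.2.2).mul (hu.cont.mul hv).continuousOn).integrableOn_compact hu.2.1

theorem local_energy {N : ℕ} {Ω : Set (Euc N)} {U m η : Euc N → ℝ} (hΩ : IsOpen Ω)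
    (hU : LocBdd Ω U) (hUm : AEStronglyMeasurable U (volume.restrict Ω))
    (hpos : ∀ u : Euc N → ℝ, TestFun Ω u → 0 ≤ QB Ω U u u)
    (hm : ContinuousOn m Ω) (hmpos : ∀ x ∈ Ω, 0 < m x)
    (hη : TestFun Ω η) (hη1 : ∀ x, |η x| ≤ 1) :
    ∃ C : ℝ, 0 ≤ C ∧ ∀ u : Euc N → ℝ, TestFun Ω u →
      ∫ x in Ω, ‖gradient (fun y => η y * u y) x‖ ^ 2 ≤
        C * (QB Ω U u u + ∫ x in Ω, m x * (u x * u x)) := by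
  obtain ⟨CU, hCU⟩ := hU _ hη.2.1 hη.2.2
  obtain ⟨CG, hCG⟩ := hη.2.1.exists_bound_of_continuousOn hη.grad_cont.continuousOn
  obtain ⟨D1, hD1, hD1'⟩ := weight_bound (c := fun x => 2 * η x ^ 2 * ‖gradient η x‖ ^ 2 + U x * η x ^ 4)
    hm hmpos hη.2.1 hη.2.2 (C := 2 * CG ^ 2 + CU) (by
      intro x hx
      have h1 := hCU x hx
      have h2 := hCG x hx
      have h3 : η x ^ 2 ≤ 1 := by rw [sq_le_one_iff_abs_le_one]; exact hη1 x
      have h4 : ‖gradient η x‖ ^ 2 ≤ CG ^ 2 := by gcongr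
      have h5 : η x ^ 4 ≤ 1 := by nlinarith [sq_nonneg (η x)]
      calc _ ≤ |2 * η x ^ 2 * ‖gradient η x‖ ^ 2| + |U x * η x ^ 4| := abs_add_le _ _
        _ = 2 * η x ^ 2 * ‖gradient η x‖ ^ 2 + |U x| * η x ^ 4 := by
          rw [abs_of_nonneg (by positivity), abs_mul, abs_of_nonneg (a := η x ^ 4) (by positivity)]
        _ ≤ 2 * 1 * CG ^ 2 + CU * 1 := by
          gcongr
          exact (abs_nonneg _).trans h1
        _ = _ := by ring) (by
      intro x hx
      simp [image_eq_zero_of_notMem_tsupport hx])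
  obtain ⟨D2, hD2, hD2'⟩ := weight_bound (c := fun x => ‖gradient η x‖ ^ 2 - U x * η x ^ 2)
    hm hmpos hη.2.1 hη.2.2 (C := CG ^ 2 + CU) (by
      intro x hx
      have h1 := hCU x hx
      have h2 := hCG x hx
      have h3 : η x ^ 2 ≤ 1 := by rw [sq_le_one_iff_abs_le_one]; exact hη1 x
      have h4 : ‖gradient η x‖ ^ 2 ≤ CG ^ 2 := by gcongr
      calc _ ≤ |‖gradient η x‖ ^ 2| + |U x * η x ^ 2| := abs_sub _ _
        _ = ‖gradient η x‖ ^ 2 + |U x| * η x ^ 2 := by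
          rw [abs_of_nonneg (by positivity), abs_mul, abs_of_nonneg (a := η x ^ 2) (by positivity)]
        _ ≤ CG ^ 2 + CU * 1 := by
          gcongr
          exact (abs_nonneg _).trans h1
        _ = _ := by ring) (by
      intro x hx
      simp [image_eq_zero_of_notMem_tsupport hx, grad_tsupport hx])
  refine ⟨4 / 3 * (2 + (D1 / 8 + D2)), by positivity, fun u hu => ?_⟩
  have hw : TestFun Ω (fun y => η y * u y) := hu.mul_smooth hη.1
  have hz : TestFun Ω (fun y => η y * (η y * u y)) := hw.mul_smooth hη.1
  set X := ∫ x in Ω, ‖gradient (fun y => η y * u y) x‖ ^ 2 with hX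
  set I := ∫ x in Ω, m x * (u x * u x) with hI
  have hI0 : 0 ≤ I := setIntegral_nonneg hΩ.measurableSet (fun x hx =>
    mul_nonneg (hmpos x hx).le (mul_self_nonneg _))
  have hQ0 := hpos u hu
  have intw : IntegrableOn (fun x => ‖gradient (fun y => η y * u y) x‖ ^ 2) Ω := by
    have := grad_inner_integrable hw hw
    simpa only [real_inner_self_eq_norm_sq] using this
  have intm : IntegrableOn (fun x => m x * (u x * u x)) Ω := cont_integrable hm hu hu.cont
  have gw : ∀ x, gradient (fun y => η y * u y) x = η x • gradient u x + u x • gradient η x :=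
    fun x => grad_mul (hη.diff x) (hu.diff x)
  have gz : ∀ x, gradient (fun y => η y * (η y * u y)) x =
    η x • gradient (fun y => η y * u y) x + (η x * u x) • gradient η x :=
    fun x => grad_mul (hη.diff x) (hw.diff x)
  -- bound on Q(η² u)
  have hb1 : QB Ω U (fun y => η y * (η y * u y)) (fun y => η y * (η y * u y)) ≤ 2 * X + D1 * I := by
    rw [hX, hI, ← integral_const_mul, ← integral_const_mul, ← integral_add (intw.const_mul _) (intm.const_mul _)]
    refine setIntegral_mono_on (QB_integrable hU hUm hz hz)
      ((intw.const_mul _).add (intm.const_mul _)) hΩ.measurableSet (fun x hx => ?_)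
    simp only [real_inner_self_eq_norm_sq]
    have e1 : ‖gradient (fun y => η y * (η y * u y)) x‖ ^ 2 ≤
        2 * ‖gradient (fun y => η y * u y) x‖ ^ 2 + 2 * (η x * u x) ^ 2 * ‖gradient η x‖ ^ 2 := by
      rw [gz]
      set A := gradient (fun y => η y * u y) x
      have t1 := norm_add_le (η x • A) ((η x * u x) • gradient η x)
      rw [norm_smul, norm_smul] at t1
      have t2 : ‖η x • A + (η x * u x) • gradient η x‖ ^ 2 ≤ (‖η x‖ * ‖A‖ + ‖η x * u x‖ * ‖gradient η x‖) ^ 2 := by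
        gcongr
      have t3 : (‖η x‖ * ‖A‖ + ‖η x * u x‖ * ‖gradient η x‖) ^ 2 ≤
        2 * (‖η x‖ * ‖A‖) ^ 2 + 2 * (‖η x * u x‖ * ‖gradient η x‖) ^ 2 := by
        nlinarith [sq_nonneg (‖η x‖ * ‖A‖ - ‖η x * u x‖ * ‖gradient η x‖)]
      have t4 : (‖η x‖ * ‖A‖) ^ 2 ≤ ‖A‖ ^ 2 := by
        have : ‖η x‖ ≤ 1 := hη1 x
        gcongr
        calc ‖η x‖ * ‖A‖ ≤ 1 * ‖A‖ := by gcongr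
          _ = ‖A‖ := one_mul _
      have t5 : (‖η x * u x‖ * ‖gradient η x‖) ^ 2 = (η x * u x) ^ 2 * ‖gradient η x‖ ^ 2 := by
        rw [mul_pow, Real.norm_eq_abs, sq_abs]
      linarith
    have e2 := hD1' x hx
    have e3 : (2 * η x ^ 2 * ‖gradient η x‖ ^ 2 + U x * η x ^ 4) * (u x * u x) ≤ D1 * m x * (u x * u x) :=
      mul_le_mul_of_nonneg_right ((le_abs_self _).trans e2) (mul_self_nonneg _)
    nlinarith
  have hb2 : X ≤ QB Ω U u (fun y => η y * (η y * u y)) + D2 * I := by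
    rw [hX, hI, QB, ← integral_const_mul, ← integral_add (QB_integrable hU hUm hu hz) (intm.const_mul _)]
    refine setIntegral_mono_on intw
      ((QB_integrable hU hUm hu hz).add (intm.const_mul _)) hΩ.measurableSet (fun x hx => ?_)
    have e2 := hD2' x hx
    have e3 : (‖gradient η x‖ ^ 2 - U x * η x ^ 2) * (u x * u x) ≤ D2 * m x * (u x * u x) :=
      mul_le_mul_of_nonneg_right ((le_abs_self _).trans e2) (mul_self_nonneg _)
    have e4 : ‖gradient (fun y => η y * u y) x‖ ^ 2 =
      inner ℝ (gradient u x) (gradient (fun y => η y * (η y * u y)) x) + u x ^ 2 * ‖gradient η x‖ ^ 2 := by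
      rw [gz, ← real_inner_self_eq_norm_sq, ← real_inner_self_eq_norm_sq, gw]
      simp only [inner_add_left, inner_add_right, inner_smul_left, inner_smul_right]
      rw [real_inner_comm (gradient u x) (gradient η x)]
      simp
      ring
    rw [e4]
    nlinarith
  have hb3 := (le_abs_self _).trans (QB_amgm hU hUm hpos hu hz (a := 4) (by norm_num))
  nlinarith

theorem sq_integral_le {a : ℝ → ℝ} (ha : Continuous a) :
    (∫ s in (0:ℝ)..1, a s) ^ 2 ≤ ∫ s in (0:ℝ)..1, a s ^ 2 := by
  set c := ∫ s in (0:ℝ)..1, a s with hc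
  have h0 : 0 ≤ ∫ s in (0:ℝ)..1, (a s - c) ^ 2 :=
    intervalIntegral.integral_nonneg (by norm_num) (fun s _ => sq_nonneg _)
  have e : ∫ s in (0:ℝ)..1, (a s - c) ^ 2 = (∫ s in (0:ℝ)..1, a s ^ 2) - 2 * c * c + c ^ 2 := by
    have : ∀ s, (a s - c) ^ 2 = (a s ^ 2 - 2 * c * a s) + c ^ 2 := fun s => by ring
    simp only [this]
    rw [intervalIntegral.integral_add, intervalIntegral.integral_sub,
      intervalIntegral.integral_const_mul, ← hc]
    · simp
    all_goals exact Continuous.intervalIntegrable (by fun_prop) _ _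
  rw [e] at h0
  nlinarith

theorem translate_est {N : ℕ} {w : Euc N → ℝ} (hw : ContDiff ℝ (⊤ : ℕ∞) w)
    (hwc : HasCompactSupport w) (h : Euc N) :
    ∫ x, (w x - w (x - h)) ^ 2 ≤ ‖h‖ ^ 2 * ∫ x, ‖gradient w x‖ ^ 2 := by
  have hT : TestFun Set.univ w := ⟨hw, hwc, Set.subset_univ _⟩
  have hgc : Continuous (gradient w) := hT.grad_cont
  have hgi : Integrable (fun x => ‖gradient w x‖ ^ 2) := by
    have := grad_inner_integrable hT hT
    simpa only [real_inner_self_eq_norm_sq, integrableOn_univ] using this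
  have hpt : ∀ x, (w x - w (x - h)) ^ 2 ≤ ‖h‖ ^ 2 * ∫ s in (0:ℝ)..1, ‖gradient w (x - s • h)‖ ^ 2 := by
    intro x
    have hd : ∀ s ∈ Set.uIcc (0:ℝ) 1, HasDerivAt (fun s : ℝ => w (x - s • h))
        (inner ℝ (gradient w (x - s • h)) (-h)) s := by
      intro s _
      have h1 : HasDerivAt (fun s : ℝ => x - s • h) (-h) s := by
        have := ((hasDerivAt_id s).smul_const h).const_sub x
        simpa using this
      have h2 := (hT.diff (x - s • h)).hasFDerivAt.comp_hasDerivAt s h1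
      rw [inner_gradient_left]
      exact h2
    have hcont : Continuous (fun s : ℝ => (inner ℝ (gradient w (x - s • h)) (-h) : ℝ)) := by
      fun_prop
    have hF := intervalIntegral.integral_eq_sub_of_hasDerivAt hd (hcont.intervalIntegrable _ _)
    simp only [one_smul, zero_smul, sub_zero] at hF
    have : (w x - w (x - h)) ^ 2 = (∫ s in (0:ℝ)..1, (inner ℝ (gradient w (x - s • h)) (-h) : ℝ)) ^ 2 := by
      rw [hF]; ring
    rw [this, ← intervalIntegral.integral_const_mul]
    refine (sq_integral_le hcont).trans ?_
    refine intervalIntegral.integral_mono_on (by norm_num) ((hcont.pow 2).intervalIntegrable _ _) ?_ ?_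
    · exact Continuous.intervalIntegrable (by fun_prop) _ _
    · intro s _
      have := abs_real_inner_le_norm (gradient w (x - s • h)) (-h)
      rw [norm_neg] at this
      rw [← sq_abs, ← mul_pow, mul_comm]
      gcongr
  have hprod : Integrable (fun p : Euc N × ℝ => ‖gradient w (p.1 - p.2 • h)‖ ^ 2)
      ((volume : Measure (Euc N)).prod (volume.restrict (Set.Ioc (0:ℝ) 1))) := by
    rw [integrable_prod_iff']
    · refine ⟨Eventually.of_forall (fun s => hgi.comp_sub_right (s • h)), ?_⟩
      simp only [norm_pow, norm_norm]
      have : (fun s : ℝ => ∫ x, ‖gradient w (x - s • h)‖ ^ 2) = fun s => ∫ x, ‖gradient w x‖ ^ 2 := by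
        ext s
        exact integral_sub_right_eq_self (fun x => ‖gradient w x‖ ^ 2) (s • h)
      rw [this]
      exact integrable_const _
    · exact Continuous.aestronglyMeasurable (by fun_prop)
  calc ∫ x, (w x - w (x - h)) ^ 2
      ≤ ∫ x, ‖h‖ ^ 2 * ∫ s in (0:ℝ)..1, ‖gradient w (x - s • h)‖ ^ 2 := by
        refine integral_mono_of_nonneg (Eventually.of_forall fun x => sq_nonneg _) ?_
          (Eventually.of_forall hpt)
        simp only [intervalIntegral.integral_of_le (zero_le_one' ℝ)]
        exact hprod.integral_prod_left.const_mul _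
    _ = ‖h‖ ^ 2 * ∫ x, ‖gradient w x‖ ^ 2 := by
        rw [integral_const_mul]
        congr 1
        simp only [intervalIntegral.integral_of_le (zero_le_one' ℝ)]
        rw [integral_integral_swap hprod]
        have : (fun s : ℝ => ∫ x, ‖gradient w (x - s • h)‖ ^ 2) = fun s => ∫ x, ‖gradient w x‖ ^ 2 := by
          ext s
          exact integral_sub_right_eq_self (fun x => ‖gradient w x‖ ^ 2) (s • h)
        rw [this]
        simp

theorem mollify_est {N : ℕ} {w ρ : Euc N → ℝ} {K : Set (Euc N)} {ε : ℝ}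
    (hw : ContDiff ℝ (⊤ : ℕ∞) w) (hK : IsCompact K) (hwK : ∀ x, x ∉ K → w x = 0)
    (hρ : Continuous ρ) (hρi : Integrable ρ) (hρ0 : ∀ x, 0 ≤ ρ x) (hρ1 : ∫ x, ρ x = 1)
    (hρs : ∀ x, ε < ‖x‖ → ρ x = 0) (hε : 0 ≤ ε) :
    ∫ x, w x ^ 2 ≤ ε ^ 2 * (∫ x, ‖gradient w x‖ ^ 2) + ∫ x in K, (∫ y, ρ (x - y) * w y) ^ 2 := by
  have hwc : HasCompactSupport w := HasCompactSupport.intro hK (fun x hx => hwK x hx)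
  have hwi : Integrable w := hw.continuous.integrable_of_hasCompactSupport hwc
  have hw2 : Integrable (fun x => w x ^ 2) := by
    refine (hw.continuous.pow 2).integrable_of_hasCompactSupport ?_
    exact HasCompactSupport.intro hK (fun x hx => by simp [hwK x hx])
  obtain ⟨M, hM⟩ := hwc.exists_bound_of_continuous hw.continuous
  set A := ∫ x, w x ^ 2 with hA
  set X := ∫ x, ‖gradient w x‖ ^ 2 with hX
  have hX0 : 0 ≤ X := integral_nonneg (fun x => sq_nonneg _)
  have cint : ∀ h, Integrable (fun x => w x * w (x - h)) := fun h => by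
    refine (hwi.mul_bdd (c := M) (f := w) (g := fun x => w (x - h)) ?_ ?_)
    · exact Continuous.aestronglyMeasurable (by have := hw.continuous; fun_prop)
    · exact Eventually.of_forall (fun x => hM _)
  have hc : ∀ h, ρ h * (2 * A - 2 * ∫ x, w x * w (x - h)) ≤ ρ h * (ε ^ 2 * X) := by
    intro h
    by_cases hh : ε < ‖h‖
    · simp [hρs h hh]
    · push Not at hh
      refine mul_le_mul_of_nonneg_left ?_ (hρ0 h)
      have h1 := translate_est hw hwc h
      have e : ∫ x, (w x - w (x - h)) ^ 2 = 2 * A - 2 * ∫ x, w x * w (x - h) := by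
        have : ∀ x, (w x - w (x - h)) ^ 2 = (w x ^ 2 + w (x - h) ^ 2) - 2 * (w x * w (x - h)) :=
          fun x => by ring
        simp only [this]
        have i1 : Integrable (fun x => w (x - h) ^ 2) := hw2.comp_sub_right h
        have i2 : Integrable (fun x => w x ^ 2 + w (x - h) ^ 2) := hw2.add i1
        rw [integral_sub i2 ((cint h).const_mul 2),
          integral_add hw2 i1, integral_const_mul,
          integral_sub_right_eq_self (fun x => w x ^ 2) h]
        ring
      rw [e] at h1
      refine h1.trans ?_
      gcongr
  have hprod : Integrable (fun p : Euc N × Euc N => ρ p.1 * (w p.2 * w (p.2 - p.1)))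
      ((volume : Measure (Euc N)).prod volume) := by
    have h1 : Integrable (fun p : Euc N × Euc N => ρ p.1 * w p.2) ((volume : Measure (Euc N)).prod volume) :=
      hρi.mul_prod hwi
    have h2 := h1.mul_bdd (c := M) (g := fun p : Euc N × Euc N => w (p.2 - p.1))
      (Continuous.aestronglyMeasurable (by have := hw.continuous; fun_prop))
      (Eventually.of_forall (fun p => hM _))
    refine h2.congr (Eventually.of_forall fun p => ?_)
    simp only [mul_assoc]
  have hρc : Integrable (fun h => ρ h * ∫ x, w x * w (x - h)) := by
    have := hprod.integral_prod_left
    simpa only [integral_const_mul] using this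
  have hIntg : 2 * A - 2 * ∫ h, ρ h * ∫ x, w x * w (x - h) ≤ ε ^ 2 * X := by
    have h1 : ∫ h, ρ h * (2 * A - 2 * ∫ x, w x * w (x - h)) ≤ ∫ h, ρ h * (ε ^ 2 * X) := by
      refine integral_mono ?_ (hρi.mul_const _) hc
      have := (hρi.mul_const (2 * A)).sub (hρc.const_mul 2)
      refine this.congr (Eventually.of_forall fun h => ?_)
      simp only [Pi.sub_apply]; ring
    have e1 : ∫ h, ρ h * (2 * A - 2 * ∫ x, w x * w (x - h)) =
        2 * A - 2 * ∫ h, ρ h * ∫ x, w x * w (x - h) := by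
      have : ∀ h, ρ h * (2 * A - 2 * ∫ x, w x * w (x - h)) =
        ρ h * (2 * A) - 2 * (ρ h * ∫ x, w x * w (x - h)) := fun h => by ring
      simp only [this]
      rw [integral_sub (hρi.mul_const _) (hρc.const_mul 2), integral_mul_const, integral_const_mul, hρ1,
        one_mul]
    rw [e1, integral_mul_const, hρ1, one_mul] at h1
    exact h1
  -- swap
  have hswap : ∫ h, ρ h * ∫ x, w x * w (x - h) = ∫ x, w x * ∫ y, ρ (x - y) * w y := by
    have e1 : ∀ h, ρ h * ∫ x, w x * w (x - h) = ∫ x, ρ h * (w x * w (x - h)) := fun h => by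
      rw [integral_const_mul]
    simp only [e1]
    rw [integral_integral_swap hprod]
    congr 1; ext x
    rw [← integral_const_mul, ← integral_sub_left_eq_self _ volume x]
    congr 1; ext y
    simp
    ring
  rw [hswap] at hIntg
  have hJc : Continuous (fun x => ∫ y, ρ (x - y) * w y) := by
    have e : ∀ x, ∫ y, ρ (x - y) * w y = ∫ y in K, ρ (x - y) * w y := fun x => by
      rw [setIntegral_eq_integral_of_forall_compl_eq_zero]
      intro y hy; simp [hwK y hy]
    simp only [e]
    refine continuous_parametric_integral_of_continuous (f := fun x y => ρ (x - y) * w y) ?_ hK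
    have := hw.continuous
    simp only [Function.uncurry_def]
    fun_prop
  have hJK : ∫ x, w x * ∫ y, ρ (x - y) * w y ≤ A / 2 + (∫ x in K, (∫ y, ρ (x - y) * w y) ^ 2) / 2 := by
    have e1 : ∫ x, w x * ∫ y, ρ (x - y) * w y = ∫ x in K, w x * ∫ y, ρ (x - y) * w y := by
      rw [setIntegral_eq_integral_of_forall_compl_eq_zero]
      intro x hx; simp [hwK x hx]
    have e2 : A = ∫ x in K, w x ^ 2 := by
      rw [hA, setIntegral_eq_integral_of_forall_compl_eq_zero]
      intro x hx; simp [hwK x hx]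
    rw [e1, e2, ← integral_div, ← integral_div, ← integral_add]
    · refine integral_mono ?_ ?_ ?_
      · exact (hw.continuous.mul hJc).continuousOn.integrableOn_compact hK
      · exact (((hw.continuous.pow 2).div_const 2).add ((hJc.pow 2).div_const 2)).continuousOn.integrableOn_compact hK
      · intro x
        simp only
        nlinarith [sq_nonneg (w x - ∫ y, ρ (x - y) * w y)]
    · exact ((hw.continuous.pow 2).div_const 2).continuousOn.integrableOn_compact hK
    · exact ((hJc.pow 2).div_const 2).continuousOn.integrableOn_compact hK
  linarith

theorem grad_sub {N : ℕ} {u v : Euc N → ℝ} {x : Euc N} (hu : DifferentiableAt ℝ u x)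
    (hv : DifferentiableAt ℝ v x) :
    gradient (fun y => u y - v y) x = gradient u x - gradient v x := by
  unfold gradient
  rw [fderiv_fun_sub hu hv, map_sub]

theorem rellich {N : ℕ} {w : ℕ → Euc N → ℝ} {K : Set (Euc N)} {C C1 : ℝ}
    (hw : ∀ k, ContDiff ℝ (⊤ : ℕ∞) (w k)) (hK : IsCompact K) (hwK : ∀ k x, x ∉ K → w k x = 0)
    (hC : ∀ k, ∫ x, ‖gradient (w k) x‖ ^ 2 ≤ C) (hC1 : ∀ k, ∫ x, |w k x| ≤ C1)
    (hweak : ∀ ψ : Euc N → ℝ, Continuous ψ → ∃ L : ℝ, Tendsto (fun k => ∫ x, ψ x * w k x) atTop (𝓝 L)) :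
    Tendsto (fun p : ℕ × ℕ => ∫ x, (w p.1 x - w p.2 x) ^ 2) atTop (𝓝 0) := by
  have hC0 : 0 ≤ C := (integral_nonneg (fun x => sq_nonneg _)).trans (hC 0)
  have hwc : ∀ k, HasCompactSupport (w k) := fun k => HasCompactSupport.intro hK (fun x hx => hwK k x hx)
  have hT : ∀ k, TestFun Set.univ (w k) := fun k => ⟨hw k, hwc k, Set.subset_univ _⟩
  have hwi : ∀ k, Integrable (w k) := fun k => (hw k).continuous.integrable_of_hasCompactSupport (hwc k)
  have hgi : ∀ k, Integrable (fun x => ‖gradient (w k) x‖ ^ 2) := fun k => by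
    have := grad_inner_integrable (hT k) (hT k)
    simpa only [real_inner_self_eq_norm_sq, integrableOn_univ] using this
  have hgrad : ∀ p : ℕ × ℕ, ∫ x, ‖gradient (fun y => w p.1 y - w p.2 y) x‖ ^ 2 ≤ 4 * C := by
    intro p
    have : ∀ x, ‖gradient (fun y => w p.1 y - w p.2 y) x‖ ^ 2 ≤
        2 * ‖gradient (w p.1) x‖ ^ 2 + 2 * ‖gradient (w p.2) x‖ ^ 2 := fun x => by
      rw [grad_sub ((hT _).diff x) ((hT _).diff x)]
      have h1 := norm_sub_le (gradient (w p.1) x) (gradient (w p.2) x)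
      have h2 : ‖gradient (w p.1) x - gradient (w p.2) x‖ ^ 2 ≤
        (‖gradient (w p.1) x‖ + ‖gradient (w p.2) x‖) ^ 2 := by gcongr
      nlinarith [sq_nonneg (‖gradient (w p.1) x‖ - ‖gradient (w p.2) x‖)]
    calc _ ≤ ∫ x, (2 * ‖gradient (w p.1) x‖ ^ 2 + 2 * ‖gradient (w p.2) x‖ ^ 2) :=
          integral_mono_of_nonneg (Eventually.of_forall fun x => sq_nonneg _)
            (((hgi _).const_mul 2).add ((hgi _).const_mul 2)) (Eventually.of_forall this)
      _ = 2 * (∫ x, ‖gradient (w p.1) x‖ ^ 2) + 2 * ∫ x, ‖gradient (w p.2) x‖ ^ 2 := by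
          rw [integral_add ((hgi _).const_mul 2) ((hgi _).const_mul 2), integral_const_mul, integral_const_mul]
      _ ≤ 4 * C := by linarith [hC p.1, hC p.2]
  rw [Metric.tendsto_nhds]
  intro δ hδ
  obtain ⟨ε, hε, hεδ⟩ : ∃ ε : ℝ, 0 < ε ∧ ε ^ 2 * (4 * C) < δ / 2 := by
    refine ⟨√(δ / (16 * (C + 1))), by positivity, ?_⟩
    rw [Real.sq_sqrt (by positivity), div_mul_eq_mul_div, div_lt_iff₀ (by positivity)]
    nlinarith
  let b : ContDiffBump (0 : Euc N) := ⟨ε / 2, ε, by linarith, by linarith⟩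
  set ρ : Euc N → ℝ := b.normed volume with hρdef
  have hρc : Continuous ρ := b.continuous_normed
  have hρi : Integrable ρ := b.integrable_normed
  obtain ⟨M, hM⟩ := b.hasCompactSupport_normed.exists_bound_of_continuous hρc
  have hJ : Tendsto (fun p : ℕ × ℕ => ∫ x in K, (∫ y, ρ (x - y) * (w p.1 y - w p.2 y)) ^ 2) atTop (𝓝 0) := by
    have hIntg : ∀ x k, Integrable (fun y => ρ (x - y) * w k y) := fun x k => by
      refine (hwi k).bdd_mul (c := M) (Continuous.aestronglyMeasurable (by fun_prop))
        (Eventually.of_forall fun y => hM _)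
    have hsplit : ∀ x (p : ℕ × ℕ), ∫ y, ρ (x - y) * (w p.1 y - w p.2 y) =
        (∫ y, ρ (x - y) * w p.1 y) - ∫ y, ρ (x - y) * w p.2 y := fun x p => by
      simp only [mul_sub]
      rw [integral_sub (hIntg x _) (hIntg x _)]
    have hb : ∀ x k, |∫ y, ρ (x - y) * w k y| ≤ M * C1 := fun x k => by
      calc |∫ y, ρ (x - y) * w k y| ≤ ∫ y, |ρ (x - y) * w k y| := abs_integral_le_integral_abs
        _ ≤ ∫ y, M * |w k y| := by
          refine integral_mono (hIntg x k).abs ((hwi k).abs.const_mul _) (fun y => ?_)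
          simp only [abs_mul]
          have := hM (x - y)
          rw [Real.norm_eq_abs] at this
          gcongr
        _ ≤ M * C1 := by
          rw [integral_const_mul]
          have : 0 ≤ M := (norm_nonneg _).trans (hM 0)
          gcongr
          exact hC1 k
    have : (0:ℝ) = ∫ x in K, (0:ℝ) := by simp
    rw [this]
    refine tendsto_integral_filter_of_dominated_convergence (fun _ => (2 * (M * C1)) ^ 2) ?_ ?_ ?_ ?_
    · refine Eventually.of_forall fun p => ?_
      refine Continuous.aestronglyMeasurable ?_
      have e : ∀ x, ∫ y, ρ (x - y) * (w p.1 y - w p.2 y) = ∫ y in K, ρ (x - y) * (w p.1 y - w p.2 y) := fun x => by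
        rw [setIntegral_eq_integral_of_forall_compl_eq_zero]
        intro y hy; simp [hwK _ y hy]
      simp only [e]
      refine Continuous.pow (continuous_parametric_integral_of_continuous
        (f := fun x y => ρ (x - y) * (w p.1 y - w p.2 y)) ?_ hK) 2
      have h1 := (hw p.1).continuous
      have h2 := (hw p.2).continuous
      simp only [Function.uncurry_def]
      fun_prop
    · refine Eventually.of_forall fun p => Eventually.of_forall fun x => ?_
      rw [hsplit, Real.norm_eq_abs, abs_pow]
      gcongr
      refine (abs_sub _ _).trans ?_
      linarith [hb x p.1, hb x p.2]
    · haveI : IsFiniteMeasure (volume.restrict K) := ⟨by simpa using hK.measure_lt_top⟩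
      exact integrable_const _
    · refine Eventually.of_forall fun x => ?_
      simp only [hsplit]
      obtain ⟨L, hL⟩ := hweak (fun y => ρ (x - y)) (by fun_prop)
      have h1 : Tendsto (fun p : ℕ × ℕ => ∫ y, ρ (x - y) * w p.1 y) atTop (𝓝 L) := by
        rw [← prod_atTop_atTop_eq]; exact hL.comp tendsto_fst
      have h2 : Tendsto (fun p : ℕ × ℕ => ∫ y, ρ (x - y) * w p.2 y) atTop (𝓝 L) := by
        rw [← prod_atTop_atTop_eq]; exact hL.comp tendsto_snd
      have := (h1.sub h2).pow 2
      simpa using this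
  have hev := (Metric.tendsto_nhds.1 hJ) (δ / 2) (by linarith)
  filter_upwards [hev] with p hp
  rw [Real.dist_0_eq_abs, abs_of_nonneg (integral_nonneg fun x => sq_nonneg _)]
  rw [Real.dist_0_eq_abs] at hp
  have h1 := mollify_est (w := fun y => w p.1 y - w p.2 y) (ρ := ρ) (ε := ε) (K := K)
    ((hw _).sub (hw _)) hK (fun x hx => by simp [hwK _ x hx]) hρc hρi (fun x => b.nonneg_normed x)
    b.integral_normed (fun x hx => by
      have : x ∉ Function.support ρ := by
        rw [hρdef, b.support_normed_eq]
        simpa using hx.le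
      simpa using this) hε.le
  have h2 : ε ^ 2 * ∫ x, ‖gradient (fun y => w p.1 y - w p.2 y) x‖ ^ 2 ≤ ε ^ 2 * (4 * C) := by
    gcongr
    exact hgrad p
  have h3 := le_abs_self (∫ x in K, (∫ y, ρ (x - y) * (w p.1 y - w p.2 y)) ^ 2)
  linarith

theorem weak_subseq {H : Type*} [NormedAddCommGroup H] [InnerProductSpace ℝ H] [CompleteSpace H]
    [TopologicalSpace.SeparableSpace H] (v : ℕ → H) (C : ℝ) (hb : ∀ k, ‖v k‖ ≤ C) :
    ∃ n : ℕ → ℕ, StrictMono n ∧ ∃ v0 : H, ∀ h : H,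
      Tendsto (fun k => (inner ℝ (v (n k)) h : ℝ)) atTop (𝓝 (inner ℝ v0 h)) := by
  have hc := WeakDual.isSeqCompact_closedBall ℝ H (0 : StrongDual ℝ H) C
  let x : ℕ → WeakDual ℝ H := fun k => StrongDual.toWeakDual (InnerProductSpace.toDual ℝ H (v k))
  have hx : ∀ k, x k ∈ WeakDual.toStrongDual ⁻¹' Metric.closedBall (0 : StrongDual ℝ H) C := by
    intro k
    simp only [x, Set.mem_preimage, mem_closedBall_zero_iff]
    exact ((InnerProductSpace.toDual ℝ H).norm_map (v k)).le.trans (hb k)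
  obtain ⟨a, ha, n, hn, hlim⟩ := hc hx
  refine ⟨n, hn, (InnerProductSpace.toDual ℝ H).symm (WeakDual.toStrongDual a), fun h => ?_⟩
  have := (WeakDual.eval_continuous (𝕜 := ℝ) (E := H) h).continuousAt.tendsto.comp hlim
  rw [InnerProductSpace.toDual_symm_apply]
  exact this

theorem toLp_inner {α : Type*} [MeasurableSpace α] {μ : Measure α} {f g : α → ℝ}
    (hf : MemLp f 2 μ) (hg : MemLp g 2 μ) :
    (inner ℝ (hf.toLp f) (hg.toLp g) : ℝ) = ∫ x, f x * g x ∂μ := by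
  rw [L2.inner_def]
  refine integral_congr_ae ?_
  filter_upwards [hf.coeFn_toLp, hg.coeFn_toLp] with x h1 h2
  rw [h1, h2]
  simp [mul_comm]

theorem toLp_norm_sq {α : Type*} [MeasurableSpace α] {μ : Measure α} {f : α → ℝ}
    (hf : MemLp f 2 μ) : ‖hf.toLp f‖ ^ 2 = ∫ x, f x ^ 2 ∂μ := by
  rw [← real_inner_self_eq_norm_sq, toLp_inner]
  simp only [sq]

theorem strong_of_cauchy_weak {α : Type*} [MeasurableSpace α] {μ : Measure α} {f : ℕ → α → ℝ} {g : α → ℝ}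
    (hf : ∀ k, MemLp (f k) 2 μ) (hg : MemLp g 2 μ)
    (hc : Tendsto (fun p : ℕ × ℕ => ∫ x, (f p.1 x - f p.2 x) ^ 2 ∂μ) atTop (𝓝 0))
    (hw : ∀ h : α → ℝ, MemLp h 2 μ → Tendsto (fun k => ∫ x, f k x * h x ∂μ) atTop (𝓝 (∫ x, g x * h x ∂μ))) :
    Tendsto (fun k => ∫ x, (f k x - g x) ^ 2 ∂μ) atTop (𝓝 0) := by
  have hd : ∀ p : ℕ × ℕ, dist ((hf p.1).toLp (f p.1)) ((hf p.2).toLp (f p.2)) ^ 2 =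
      ∫ x, (f p.1 x - f p.2 x) ^ 2 ∂μ := fun p => by
    rw [dist_eq_norm, ← MemLp.toLp_sub, toLp_norm_sq]
    rfl
  have hcau : CauchySeq (fun k => (hf k).toLp (f k)) := by
    rw [cauchySeq_iff_tendsto_dist_atTop_0]
    have h1 : Tendsto (fun p : ℕ × ℕ => √(dist ((hf p.1).toLp (f p.1)) ((hf p.2).toLp (f p.2)) ^ 2)) atTop (𝓝 (√0)) := by
      refine (Real.continuous_sqrt.tendsto 0).comp ?_
      simp only [hd]
      exact hc
    simpa [Real.sqrt_sq dist_nonneg] using h1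
  obtain ⟨G, hG⟩ := cauchySeq_tendsto_of_complete hcau
  have hGg : G = hg.toLp g := by
    refine ext_inner_right ℝ (fun h => ?_)
    have h1 : Tendsto (fun k => (inner ℝ ((hf k).toLp (f k)) h : ℝ)) atTop (𝓝 (inner ℝ G h)) :=
      hG.inner tendsto_const_nhds
    have h2 := hw h (Lp.memLp h)
    have e : (Lp.memLp h).toLp (h : α → ℝ) = h := Lp.toLp_coeFn h _
    have e1 : ∀ k, ∫ x, f k x * h x ∂μ = inner ℝ ((hf k).toLp (f k)) h := fun k => by
      conv_rhs => rw [← e]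
      rw [toLp_inner]
    have e2 : ∫ x, g x * h x ∂μ = inner ℝ (hg.toLp g) h := by
      conv_rhs => rw [← e]
      rw [toLp_inner]
    simp only [e1, e2] at h2
    exact tendsto_nhds_unique h1 h2
  have h3 : ∀ k, ∫ x, (f k x - g x) ^ 2 ∂μ = ‖(hf k).toLp (f k) - hg.toLp g‖ ^ 2 := fun k => by
    rw [← MemLp.toLp_sub, toLp_norm_sq]
    rfl
  simp only [h3]
  rw [hGg] at hG
  have := (tendsto_iff_norm_sub_tendsto_zero.1 hG).pow 2
  simpa using this

theorem memLp_two_of_zero_off {N : ℕ} {Ω : Set (Euc N)} {m ψ : Euc N → ℝ} {K : Set (Euc N)}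
    (hΩ : IsOpen Ω) (hm : ContinuousOn m Ω) (hmpos : ∀ x ∈ Ω, 0 < m x) (hK : IsCompact K) (hKΩ : K ⊆ Ω)
    (hψ : MemLp ψ 2 (volume.restrict Ω)) (h0 : ∀ x, x ∉ K → ψ x = 0) :
    MemLp (fun x => ψ x / √(m x)) 2 (volume.restrict Ω) := by
  obtain ⟨D, hD, hD'⟩ := weight_bound (c := K.indicator 1) (C := 1) hm hmpos hK hKΩ (by
    intro x hx; simp [hx]) (by intro x hx; simp [hx])
  have hms : AEStronglyMeasurable (fun x => (√(m x))) (volume.restrict Ω) :=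
    (hm.sqrt).aestronglyMeasurable hΩ.measurableSet
  refine MemLp.of_le_mul (c := √D) hψ (hψ.1.aemeasurable.div hms.aemeasurable).aestronglyMeasurable ?_
  filter_upwards [ae_restrict_mem hΩ.measurableSet] with x hx
  by_cases hxK : x ∈ K
  · have h1 := hD' x hx
    simp [hxK] at h1
    have hmx := hmpos x hx
    have hs : 0 < √(m x) := Real.sqrt_pos.2 hmx
    rw [norm_div, Real.norm_of_nonneg hs.le, div_le_iff₀ hs]
    have : 1 ≤ √D * √(m x) := by
      rw [← Real.sqrt_mul hD]
      exact Real.one_le_sqrt.2 h1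
    nlinarith [norm_nonneg (ψ x)]
  · simp [h0 x hxK]

/-- weak compactness in weighted `L²` -/
theorem weak_limit {N : ℕ} {Ω : Set (Euc N)} {m : Euc N → ℝ} {u : ℕ → Euc N → ℝ} {A : ℝ}
    (hΩ : IsOpen Ω) (hm : ContinuousOn m Ω) (hmpos : ∀ x ∈ Ω, 0 < m x)
    (hu : ∀ k, TestFun Ω (u k)) (hA : ∀ k, ∫ x in Ω, m x * (u k x * u k x) ≤ A) :
    ∃ n : ℕ → ℕ, StrictMono n ∧ ∃ u0 : Euc N → ℝ, AEStronglyMeasurable u0 (volume.restrict Ω) ∧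
      (∀ K : Set (Euc N), IsCompact K → K ⊆ Ω → MemLp (K.indicator u0) 2 (volume.restrict Ω)) ∧
      ∀ (K : Set (Euc N)) (ψ : Euc N → ℝ), IsCompact K → K ⊆ Ω → MemLp ψ 2 (volume.restrict Ω) →
        (∀ x, x ∉ K → ψ x = 0) →
        Tendsto (fun k => ∫ x in Ω, u (n k) x * ψ x) atTop (𝓝 (∫ x in Ω, u0 x * ψ x)) := by
  have hms : AEStronglyMeasurable (fun x => (√(m x))) (volume.restrict Ω) :=
    (hm.sqrt).aestronglyMeasurable hΩ.measurableSet
  have hmem : ∀ k, MemLp (fun x => √(m x) * u k x) 2 (volume.restrict Ω) := fun k => by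
    refine (memLp_two_iff_integrable_sq (hms.mul (hu k).cont.aestronglyMeasurable)).2 ?_
    refine (cont_integrable hm (hu k) (hu k).cont).congr ?_
    filter_upwards [ae_restrict_mem hΩ.measurableSet] with x hx
    rw [Pi.mul_apply, mul_pow, Real.sq_sqrt (hmpos x hx).le, sq]
  have hnorm : ∀ k, ‖(hmem k).toLp _‖ ≤ √A := fun k => by
    apply Real.le_sqrt_of_sq_le
    rw [toLp_norm_sq]
    refine le_trans (le_of_eq ?_) (hA k)
    refine setIntegral_congr_fun hΩ.measurableSet (fun x hx => ?_)
    simp only [mul_pow]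
    rw [Real.sq_sqrt (hmpos x hx).le, sq]
  haveI : Fact ((1 : ENNReal) ≤ 2) := ⟨by norm_num⟩
  haveI : Fact ((2 : ENNReal) ≠ ⊤) := ⟨by norm_num⟩
  obtain ⟨n, hn, v0, hv0⟩ := weak_subseq (fun k => (hmem k).toLp _) (√A) hnorm
  refine ⟨n, hn, fun x => v0 x / √(m x), ((Lp.aestronglyMeasurable v0).aemeasurable.div hms.aemeasurable).aestronglyMeasurable, ?_, ?_⟩
  · intro K hK hKΩ
    have h1 : MemLp (K.indicator v0) 2 (volume.restrict Ω) := (Lp.memLp v0).indicator hK.measurableSet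
    have h2 := memLp_two_of_zero_off hΩ hm hmpos hK hKΩ h1 (fun x hx => by simp [hx])
    convert h2 using 1
    ext x
    by_cases hx : x ∈ K <;> simp [hx]
  · intro K ψ hK hKΩ hψ h0
    have h2 := memLp_two_of_zero_off hΩ hm hmpos hK hKΩ hψ h0
    have h3 := hv0 (h2.toLp _)
    have e1 : ∀ k, (inner ℝ ((hmem (n k)).toLp _) (h2.toLp _) : ℝ) = ∫ x in Ω, u (n k) x * ψ x := fun k => by
      rw [toLp_inner]
      refine setIntegral_congr_fun hΩ.measurableSet (fun x hx => ?_)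
      have := Real.sqrt_pos.2 (hmpos x hx)
      field_simp
    have e2 : (inner ℝ v0 (h2.toLp _) : ℝ) = ∫ x in Ω, v0 x / √(m x) * ψ x := by
      have e : (Lp.memLp v0).toLp (v0 : Euc N → ℝ) = v0 := Lp.toLp_coeFn v0 _
      conv_lhs => rw [← e]
      rw [toLp_inner]
      refine integral_congr_ae (Eventually.of_forall fun x => ?_)
      simp only
      ring
    simp only [e1, e2] at h3
    exact h3

theorem integral_eq_of_tsupport {N : ℕ} {Ω : Set (Euc N)} {f : Euc N → ℝ}
    (h : ∀ x, x ∉ Ω → f x = 0) : ∫ x in Ω, f x = ∫ x, f x :=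
  setIntegral_eq_integral_of_forall_compl_eq_zero h

theorem TestFun.memLp {N : ℕ} {Ω : Set (Euc N)} {u : Euc N → ℝ} (hu : TestFun Ω u) :
    MemLp u 2 (volume.restrict Ω) :=
  (hu.cont.memLp_of_hasCompactSupport hu.2.1).mono_measure Measure.restrict_le_self

/-- strong local convergence -/
theorem strong_limit {N : ℕ} {Ω : Set (Euc N)} {U m : Euc N → ℝ} {u : ℕ → Euc N → ℝ} {A B : ℝ}
    {u0 : Euc N → ℝ}
    (hΩ : IsOpen Ω) (hU : LocBdd Ω U) (hUm : AEStronglyMeasurable U (volume.restrict Ω))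
    (hpos : ∀ u : Euc N → ℝ, TestFun Ω u → 0 ≤ QB Ω U u u)
    (hm : ContinuousOn m Ω) (hmpos : ∀ x ∈ Ω, 0 < m x)
    (hu : ∀ k, TestFun Ω (u k)) (hA : ∀ k, ∫ x in Ω, m x * (u k x * u k x) ≤ A)
    (hB : ∀ k, QB Ω U (u k) (u k) ≤ B)
    (hu0 : ∀ K : Set (Euc N), IsCompact K → K ⊆ Ω → MemLp (K.indicator u0) 2 (volume.restrict Ω))
    (hweak : ∀ (K : Set (Euc N)) (ψ : Euc N → ℝ), IsCompact K → K ⊆ Ω → MemLp ψ 2 (volume.restrict Ω) →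
        (∀ x, x ∉ K → ψ x = 0) →
        Tendsto (fun k => ∫ x in Ω, u k x * ψ x) atTop (𝓝 (∫ x in Ω, u0 x * ψ x)))
    (K : Set (Euc N)) (hK : IsCompact K) (hKΩ : K ⊆ Ω) :
    Tendsto (fun k => ∫ x in K, (u k x - u0 x) ^ 2) atTop (𝓝 0) := by
  obtain ⟨η, hη, hη1, hη0, hηle⟩ := exists_cutoff hΩ hK hKΩ
  have hηabs : ∀ x, |η x| ≤ 1 := fun x => by rw [abs_of_nonneg (hη0 x)]; exact hηle x
  obtain ⟨C, hC0, hC⟩ := local_energy hΩ hU hUm hpos hm hmpos hη hηabs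
  have hwT : ∀ k, TestFun Ω (fun y => η y * u k y) := fun k => (hu k).mul_smooth hη.1
  have hoff : ∀ x, x ∉ tsupport η → η x = 0 := fun x hx => image_eq_zero_of_notMem_tsupport hx
  have hoffΩ : ∀ x, x ∉ Ω → η x = 0 := fun x hx => hoff x (fun h => hx (hη.2.2 h))
  have hgu0 : MemLp (fun x => η x * u0 x) 2 (volume.restrict Ω) := by
    refine MemLp.of_le (hu0 _ hη.2.1 hη.2.2) ?_ ?_
    · have h1 : AEStronglyMeasurable (fun x => η x * (tsupport η).indicator u0 x) (volume.restrict Ω) :=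
        hη.cont.aestronglyMeasurable.mul (hu0 _ hη.2.1 hη.2.2).1
      refine h1.congr (Eventually.of_forall fun x => ?_)
      by_cases hx : x ∈ tsupport η
      · simp [hx]
      · simp [hoff x hx]
    · refine Eventually.of_forall fun x => ?_
      by_cases hx : x ∈ tsupport η
      · simp only [norm_mul, hx, Set.indicator_of_mem]
        have : ‖η x‖ ≤ 1 := hηabs x
        nlinarith [norm_nonneg (u0 x)]
      · simp [hoff x hx]
  -- L¹ bound
  obtain ⟨D, hD0, hD⟩ := weight_bound (c := η) (C := 1) hm hmpos hη.2.1 hη.2.2 (fun x _ => hηabs x) hoff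
  have hηi : IntegrableOn η Ω := (hη.cont.integrable_of_hasCompactSupport hη.2.1).integrableOn
  have hL1 : ∀ k, ∫ x, |η x * u k x| ≤ (∫ x in Ω, η x) + D * A := by
    intro k
    rw [← integral_eq_of_tsupport (Ω := Ω) (fun x hx => by simp [hoffΩ x hx])]
    have i1 := cont_integrable hm (hu k) (hu k).cont
    calc ∫ x in Ω, |η x * u k x| ≤ ∫ x in Ω, (η x + D * (m x * (u k x * u k x))) := by
          refine setIntegral_mono_on ?_ (hηi.add (i1.const_mul D)) hΩ.measurableSet (fun x hx => ?_)
          · exact (((hwT k).cont.integrable_of_hasCompactSupport (hwT k).2.1).abs).integrableOn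
          · have h1 := hD x hx
            rw [abs_of_nonneg (hη0 x)] at h1
            rw [abs_mul, abs_of_nonneg (hη0 x)]
            have h2 : |u k x| ≤ 1 + u k x * u k x := by
              have := sq_abs (u k x)
              nlinarith [sq_nonneg (|u k x| - 1), abs_nonneg (u k x)]
            have h3 : η x * |u k x| ≤ η x * (1 + u k x * u k x) :=
              mul_le_mul_of_nonneg_left h2 (hη0 x)
            have h4 : η x * (u k x * u k x) ≤ D * m x * (u k x * u k x) :=
              mul_le_mul_of_nonneg_right h1 (mul_self_nonneg _)
            nlinarith
      _ = (∫ x in Ω, η x) + D * ∫ x in Ω, m x * (u k x * u k x) := by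
          rw [integral_add hηi (i1.const_mul D), integral_const_mul]
      _ ≤ _ := by
          have := hA k
          gcongr
  have hcau := rellich (w := fun k y => η y * u k y) (K := tsupport η) (C := C * (B + A))
    (fun k => (hwT k).1) hη.2.1 (fun k x hx => by simp [hoff x hx]) (by
      intro k
      rw [← integral_eq_of_tsupport (Ω := Ω)]
      · refine (hC _ (hu k)).trans ?_
        have h1 := hA k
        have h2 := hB k
        gcongr
      · intro x hx
        rw [grad_tsupport (fun h => hx ((hwT k).2.2 h))]
        simp) hL1 (by
      intro ψ hψ
      refine ⟨∫ x in Ω, u0 x * (η x * ψ x), ?_⟩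
      have hT : MemLp (fun x => η x * ψ x) 2 (volume.restrict Ω) := by
        refine (Continuous.memLp_of_hasCompactSupport (hη.cont.mul hψ) ?_).mono_measure Measure.restrict_le_self
        exact hη.2.1.mul_right
      have := hweak (tsupport η) (fun x => η x * ψ x) hη.2.1 hη.2.2 hT
        (fun x hx => by simp [hoff x hx])
      refine this.congr (fun k => ?_)
      rw [integral_eq_of_tsupport]
      · congr 1; ext x; ring
      · intro x hx; simp [hoffΩ x hx])
  have hst := strong_of_cauchy_weak (μ := volume.restrict Ω) (f := fun k y => η y * u k y)
    (g := fun x => η x * u0 x) (fun k => (hwT k).memLp) hgu0 (by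
      refine hcau.congr (fun p => ?_)
      rw [integral_eq_of_tsupport]
      intro x hx; simp [hoffΩ x hx]) (by
      intro h hh
      have hT : MemLp (fun x => η x * h x) 2 (volume.restrict Ω) := by
        refine MemLp.of_le hh (hη.cont.aestronglyMeasurable.mul hh.1) (Eventually.of_forall fun x => ?_)
        rw [norm_mul]
        have : ‖η x‖ ≤ 1 := hηabs x
        nlinarith [norm_nonneg (h x)]
      have := hweak (tsupport η) (fun x => η x * h x) hη.2.1 hη.2.2 hT
        (fun x hx => by simp [hoff x hx])
      have e : ∀ x, η x * u0 x * h x = u0 x * (η x * h x) := fun x => by ring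
      simp only [e]
      refine this.congr (fun k => ?_)
      congr 1; ext x; ring)
  refine squeeze_zero (fun k => integral_nonneg fun x => sq_nonneg _) (fun k => ?_) hst
  have hi : IntegrableOn (fun x => (η x * u k x - η x * u0 x) ^ 2) Ω :=
    ((hwT k).memLp.sub hgu0).integrable_sq
  calc ∫ x in K, (u k x - u0 x) ^ 2 = ∫ x in K, (η x * u k x - η x * u0 x) ^ 2 := by
        refine setIntegral_congr_fun hK.measurableSet (fun x hx => ?_)
        simp [hη1 x hx]
    _ ≤ _ := setIntegral_mono_set hi (Eventually.of_forall fun x => sq_nonneg _) hKΩ.eventuallyLE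

def sg {N : ℕ} (z : Euc N) : ℝ := - expNegInvGlue (1 - ‖z‖ ^ 2)

def rh {N : ℕ} (z : Euc N) : ℝ := 2 * ((1 - ‖z‖ ^ 2)⁻¹ ^ 2 * expNegInvGlue (1 - ‖z‖ ^ 2))

theorem sg_contDiff {N : ℕ} : ContDiff ℝ (⊤ : ℕ∞) (sg : Euc N → ℝ) := by
  unfold sg
  exact (expNegInvGlue.contDiff.comp (contDiff_const.sub (contDiff_norm_sq ℝ))).neg

theorem glue_deriv (s : ℝ) : HasDerivAt expNegInvGlue (s⁻¹ ^ 2 * expNegInvGlue s) s := by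
  have := expNegInvGlue.hasDerivAt_polynomial_eval_inv_mul 1 s
  simpa using this

theorem rh_contDiff {N : ℕ} : ContDiff ℝ (⊤ : ℕ∞) (rh : Euc N → ℝ) := by
  unfold rh
  have h := expNegInvGlue.contDiff_polynomial_eval_inv_mul (n := (⊤ : ℕ∞)) (Polynomial.X ^ 2)
  simp only [Polynomial.eval_pow, Polynomial.eval_X] at h
  exact contDiff_const.mul (h.comp (contDiff_const.sub (contDiff_norm_sq ℝ)))

theorem rh_cont {N : ℕ} : Continuous (rh : Euc N → ℝ) := rh_contDiff.continuous

theorem sg_cont {N : ℕ} : Continuous (sg : Euc N → ℝ) := sg_contDiff.continuous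

theorem rh_nonneg {N : ℕ} (z : Euc N) : 0 ≤ rh z := by
  unfold rh
  have := expNegInvGlue.nonneg (1 - ‖z‖ ^ 2)
  positivity

theorem rh_zero {N : ℕ} {z : Euc N} (h : 1 ≤ ‖z‖) : rh z = 0 := by
  unfold rh
  rw [expNegInvGlue.zero_of_nonpos (by nlinarith)]
  simp

theorem sg_zero {N : ℕ} {z : Euc N} (h : 1 ≤ ‖z‖) : sg z = 0 := by
  unfold sg
  rw [expNegInvGlue.zero_of_nonpos (by nlinarith)]
  simp

theorem abs_sg_le {N : ℕ} (z : Euc N) : |sg z| ≤ rh z / 2 := by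
  rcases le_or_gt 1 ‖z‖ with h | h
  · simp [rh_zero h, sg_zero h]
  · unfold sg rh
    have h0 := expNegInvGlue.nonneg (1 - ‖z‖ ^ 2)
    rw [abs_neg, abs_of_nonneg h0]
    have h1 : 0 < 1 - ‖z‖ ^ 2 := by nlinarith [norm_nonneg z]
    have h2 : 1 ≤ (1 - ‖z‖ ^ 2)⁻¹ := (one_le_inv₀ h1).2 (by nlinarith [norm_nonneg z])
    have h3 : 1 ≤ (1 - ‖z‖ ^ 2)⁻¹ ^ 2 := one_le_pow₀ h2
    nlinarith

theorem sg_grad {N : ℕ} (z : Euc N) : HasGradientAt sg (rh z • z) z := by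
  have h1 : HasFDerivAt (fun z : Euc N => 1 - ‖z‖ ^ 2) (-(2 • (innerSL ℝ z))) z := by
    have := (hasStrictFDerivAt_norm_sq z).hasFDerivAt.const_sub 1
    simpa using this
  have h2 := ((glue_deriv (1 - ‖z‖ ^ 2)).comp_hasFDerivAt z h1).neg
  rw [hasGradientAt_iff_hasFDerivAt]
  refine h2.congr_fderiv ?_
  ext v
  simp [rh, InnerProductSpace.toDual_apply_apply, inner_smul_left]
  ring

theorem rh_supp {N : ℕ} : HasCompactSupport (rh : Euc N → ℝ) :=
  HasCompactSupport.intro (isCompact_closedBall 0 1) (fun z hz => rh_zero (by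
    simp at hz; exact hz.le))

theorem sg_supp {N : ℕ} : HasCompactSupport (sg : Euc N → ℝ) :=
  HasCompactSupport.intro (isCompact_closedBall 0 1) (fun z hz => sg_zero (by
    simp at hz; exact hz.le))

theorem rh_bdd {N : ℕ} : ∃ R : ℝ, 0 < R ∧ ∀ z : Euc N, rh z ≤ R := by
  obtain ⟨C, hC⟩ := (rh_supp (N := N)).exists_bound_of_continuous rh_cont
  exact ⟨max C 1, by positivity, fun z => (le_abs_self _).trans ((hC z).trans (le_max_left _ _))⟩

theorem rh_int {N : ℕ} : Integrable (rh : Euc N → ℝ) :=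
  rh_cont.integrable_of_hasCompactSupport rh_supp

theorem rh_int_pos {N : ℕ} : 0 < ∫ z : Euc N, rh z := by
  refine rh_cont.integral_pos_of_hasCompactSupport_nonneg_nonzero rh_supp rh_nonneg (x := 0) ?_
  unfold rh
  have := expNegInvGlue.pos_of_pos (x := 1) (by norm_num)
  simp [this.ne']

/-- test functions -/
def psi {N : ℕ} (x : Euc N) (t : ℝ) (y : Euc N) : ℝ := t * (t ^ N)⁻¹ * sg (t⁻¹ • (x - y))

def kap {N : ℕ} (x : Euc N) (t : ℝ) (y : Euc N) : ℝ := (t ^ N)⁻¹ * rh (t⁻¹ • (x - y))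

theorem kap_nonneg {N : ℕ} {x : Euc N} {t : ℝ} (ht : 0 < t) (y : Euc N) : 0 ≤ kap x t y := by
  unfold kap
  have := rh_nonneg (t⁻¹ • (x - y))
  positivity

theorem norm_scale {N : ℕ} {x y : Euc N} {t : ℝ} (ht : 0 < t) (hy : y ∉ Metric.closedBall x t) :
    1 ≤ ‖t⁻¹ • (x - y)‖ := by
  rw [norm_smul, norm_inv, Real.norm_of_nonneg ht.le, inv_mul_eq_div, one_le_div ht]
  rw [Metric.mem_closedBall, dist_eq_norm, norm_sub_rev] at hy
  linarith

theorem kap_zero {N : ℕ} {x y : Euc N} {t : ℝ} (ht : 0 < t) (hy : y ∉ Metric.closedBall x t) :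
    kap x t y = 0 := by
  simp [kap, rh_zero (norm_scale ht hy)]

theorem psi_zero {N : ℕ} {x y : Euc N} {t : ℝ} (ht : 0 < t) (hy : y ∉ Metric.closedBall x t) :
    psi x t y = 0 := by
  simp [psi, sg_zero (norm_scale ht hy)]

theorem kap_cont {N : ℕ} (x : Euc N) (t : ℝ) : Continuous (kap x t) := by
  unfold kap
  exact continuous_const.mul (rh_cont.comp (by fun_prop))

theorem psi_contDiff {N : ℕ} (x : Euc N) (t : ℝ) : ContDiff ℝ (⊤ : ℕ∞) (psi x t) := by
  unfold psi
  exact contDiff_const.mul (sg_contDiff.comp (by fun_prop))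

theorem psi_test {N : ℕ} {Ω : Set (Euc N)} {x : Euc N} {t : ℝ} (ht : 0 < t)
    (h : Metric.closedBall x t ⊆ Ω) : TestFun Ω (psi x t) := by
  have hs : tsupport (psi x t) ⊆ Metric.closedBall x t := by
    refine closure_minimal ?_ Metric.isClosed_closedBall
    intro y hy
    by_contra hc
    exact hy (psi_zero ht hc)
  exact ⟨psi_contDiff x t, HasCompactSupport.intro (isCompact_closedBall x t) (fun y hy => psi_zero ht hy),
    hs.trans h⟩

theorem abs_psi_le {N : ℕ} {x : Euc N} {t : ℝ} (ht : 0 < t) (y : Euc N) :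
    |psi x t y| ≤ t / 2 * kap x t y := by
  unfold psi kap
  rw [abs_mul, abs_of_nonneg (by positivity : 0 ≤ t * (t ^ N)⁻¹)]
  have := abs_sg_le (t⁻¹ • (x - y))
  have h2 : 0 ≤ t * (t ^ N)⁻¹ := by positivity
  nlinarith

theorem psi_grad {N : ℕ} {x : Euc N} {t : ℝ} (ht : 0 < t) (y : Euc N) :
    gradient (psi x t) y = - (kap x t y • t⁻¹ • (x - y)) := by
  refine HasGradientAt.gradient ?_
  rw [hasGradientAt_iff_hasFDerivAt]
  have h1 : HasFDerivAt (fun y : Euc N => t⁻¹ • (x - y)) (t⁻¹ • (-ContinuousLinearMap.id ℝ (Euc N))) y :=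
    ((hasFDerivAt_id y).const_sub x).const_smul t⁻¹
  have h2 := (((sg_grad (t⁻¹ • (x - y))).hasFDerivAt.comp y h1).const_mul (t * (t ^ N)⁻¹))
  refine h2.congr_fderiv ?_
  ext v
  simp [kap, InnerProductSpace.toDual_apply_apply, inner_smul_left]
  field_simp

theorem psi_grad_norm {N : ℕ} {x : Euc N} {t : ℝ} (ht : 0 < t) (y : Euc N) :
    ‖gradient (psi x t) y‖ ≤ kap x t y := by
  rw [psi_grad ht, norm_neg, norm_smul, Real.norm_of_nonneg (kap_nonneg ht y)]
  by_cases hy : y ∈ Metric.closedBall x t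
  · have : ‖t⁻¹ • (x - y)‖ ≤ 1 := by
      rw [norm_smul, norm_inv, Real.norm_of_nonneg ht.le, inv_mul_eq_div, div_le_one ht]
      rwa [Metric.mem_closedBall, dist_eq_norm, norm_sub_rev] at hy
    nlinarith [kap_nonneg (x := x) ht y]
  · simp [kap_zero ht hy]

theorem kap_le {N : ℕ} {x : Euc N} {t s R : ℝ} (hs : 0 < s) (hst : s ≤ t) (hR : ∀ z : Euc N, rh z ≤ R)
    (y : Euc N) : kap x t y ≤ (s ^ N)⁻¹ * R := by
  unfold kap
  have := rh_nonneg (t⁻¹ • (x - y))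
  have := hR (t⁻¹ • (x - y))
  gcongr

theorem scale_integral {N : ℕ} {x : Euc N} {t : ℝ} (ht : 0 < t) (H : Euc N → ℝ) :
    ∫ z, H (x - t • z) = (t ^ N)⁻¹ * ∫ y, H y := by
  have h1 := Measure.integral_comp_smul (volume : Measure (Euc N)) (fun w => H (x - w)) t
  rw [h1, integral_sub_left_eq_self (f := H)]
  simp [abs_of_pos ht]

theorem kap_integral {N : ℕ} {x : Euc N} {t : ℝ} (ht : 0 < t) (u : Euc N → ℝ) :
    ∫ y, kap x t y * u y = ∫ z, rh z * u (x - t • z) := by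
  have h := scale_integral (x := x) ht (fun y => rh (t⁻¹ • (x - y)) * u y)
  simp only [sub_sub_cancel, smul_smul, inv_mul_cancel₀ ht.ne', one_smul] at h
  rw [h, ← integral_const_mul]
  congr 1; ext y
  unfold kap; ring

theorem kap_deriv {N : ℕ} {Ω : Set (Euc N)} {u : Euc N → ℝ} (hu : TestFun Ω u) (x : Euc N) {t : ℝ} (ht : 0 < t) :
    HasDerivAt (fun s => ∫ y, kap x s y * u y)
      (∫ y, inner ℝ (gradient u y) (gradient (psi x t) y)) t := by
  obtain ⟨R, hR, hR'⟩ := rh_bdd (N := N)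
  obtain ⟨C, hC⟩ : ∃ C, ∀ y, ‖gradient u y‖ ≤ C := by
    have : HasCompactSupport (gradient u) := HasCompactSupport.intro hu.2.1 (fun y hy => grad_tsupport hy)
    exact this.exists_bound_of_continuous hu.grad_cont
  have e : (fun s => ∫ y, kap x s y * u y) =ᶠ[𝓝 t] fun s => ∫ z, rh z * u (x - s • z) := by
    filter_upwards [lt_mem_nhds ht] with s hs
    exact kap_integral hs u
  have e2 : (∫ y, inner ℝ (gradient u y) (gradient (psi x t) y)) =
      ∫ z, rh z * (- inner ℝ (gradient u (x - t • z)) z) := by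
    have h := scale_integral (x := x) ht (fun y => rh (t⁻¹ • (x - y)) * (- inner ℝ (gradient u y) (t⁻¹ • (x - y))))
    simp only [sub_sub_cancel, smul_smul, inv_mul_cancel₀ ht.ne', one_smul] at h
    rw [h, ← integral_const_mul]
    congr 1; ext y
    rw [psi_grad ht, kap, inner_neg_right, inner_smul_right]
    ring
  rw [e2]
  refine HasDerivAt.congr_of_eventuallyEq ?_ e
  have := hasDerivAt_integral_of_dominated_loc_of_deriv_le (μ := volume) (s := Set.univ) (x₀ := t)
    (F := fun s z => rh z * u (x - s • z))
    (F' := fun s z => rh z * (- inner ℝ (gradient u (x - s • z)) z)) (bound := fun z => rh z * C) univ_mem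
    (Eventually.of_forall fun s => (rh_cont.mul (hu.cont.comp (by fun_prop))).aestronglyMeasurable)
    (Continuous.integrable_of_hasCompactSupport (rh_cont.mul (hu.cont.comp (by fun_prop))) rh_supp.mul_right)
    ((rh_cont.mul ((hu.grad_cont.comp (by fun_prop)).inner continuous_id).neg).aestronglyMeasurable)
    (Eventually.of_forall fun z s _ => by
      rw [norm_mul, Real.norm_of_nonneg (rh_nonneg z), norm_neg]
      rcases le_or_gt 1 ‖z‖ with h | h
      · simp [rh_zero h]
      · refine mul_le_mul_of_nonneg_left ?_ (rh_nonneg z)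
        refine (norm_inner_le_norm _ _).trans ?_
        have := hC (x - s • z)
        nlinarith [norm_nonneg z, norm_nonneg (gradient u (x - s • z))])
    (rh_int.mul_const C)
    (Eventually.of_forall fun z s _ => by
      have h1 : HasDerivAt (fun s : ℝ => x - s • z) (-z) s := by
        simpa using ((hasDerivAt_id s).smul_const z).const_sub x
      have h2 := ((hu.diff (x - s • z)).hasGradientAt.hasFDerivAt.comp_hasDerivAt s h1).const_mul (rh z)
      have e3 : (InnerProductSpace.toDual ℝ (Euc N)) (gradient u (x - s • z)) (-z) =
          - inner ℝ (gradient u (x - s • z)) z := by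
        rw [InnerProductSpace.toDual_apply_apply, inner_neg_right]
      rw [e3] at h2
      exact h2)
  exact this.2

theorem bmul_integrable {N : ℕ} {Ω K : Set (Euc N)} {b u0 : Euc N → ℝ} {B : ℝ}
    (hb : AEStronglyMeasurable b (volume.restrict Ω)) (hK : IsCompact K) (hKΩ : K ⊆ Ω)
    (hB : ∀ x ∈ K, |b x| ≤ B) (h0 : ∀ x, x ∉ K → b x = 0) (hu0 : IntegrableOn u0 K) :
    IntegrableOn (fun y => b y * u0 y) Ω := by
  refine integrableOn_of_zero_off hK hKΩ ?_ (fun x hx => by simp [h0 x hx])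
  refine Integrable.bdd_mul (c := B) hu0 (hb.mono_measure (Measure.restrict_mono hKΩ le_rfl)) ?_
  exact (ae_restrict_mem hK.measurableSet).mono (fun x hx => by simpa using hB x hx)

theorem integral_shrink {N : ℕ} {Ω K : Set (Euc N)} {f : Euc N → ℝ} (hKΩ : K ⊆ Ω)
    (h0 : ∀ x, x ∉ K → f x = 0) : ∫ x in Ω, f x = ∫ x in K, f x := by
  rw [integral_eq_of_tsupport h0, integral_eq_of_tsupport (fun x hx => h0 x (fun h => hx (hKΩ h)))]

theorem lim_bound {N : ℕ} {Ω K : Set (Euc N)} {b u0 v : Euc N → ℝ} {B : ℝ}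
    (hb : AEStronglyMeasurable b (volume.restrict Ω)) (hK : IsCompact K) (hKΩ : K ⊆ Ω)
    (hB : ∀ x ∈ K, |b x| ≤ B) (h0 : ∀ x, x ∉ K → b x = 0) (hu0 : IntegrableOn u0 K) (hv : Continuous v) :
    |(∫ y in Ω, b y * v y) - ∫ y in Ω, b y * u0 y| ≤ B * ∫ y in K, |v y - u0 y| := by
  have hv' : IntegrableOn v K := hv.continuousOn.integrableOn_compact hK
  rw [← integral_sub (bmul_integrable hb hK hKΩ hB h0 hv') (bmul_integrable hb hK hKΩ hB h0 hu0)]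
  have e : ∀ y, b y * v y - b y * u0 y = b y * (v y - u0 y) := fun y => by ring
  simp only [e]
  rw [integral_shrink hKΩ (fun y hy => by simp [h0 y hy])]
  · rw [← integral_const_mul]
    refine (norm_integral_le_integral_norm (fun y => b y * (v y - u0 y))).trans ?_
    have hi := (hv'.sub hu0).abs
    refine setIntegral_mono_on ?_ (hi.const_mul B) hK.measurableSet (fun y hy => ?_)
    · have := (bmul_integrable hb hK hKΩ hB h0 (hv'.sub hu0)).mono_set hKΩ
      exact this.norm
    · rw [norm_mul]
      exact mul_le_mul_of_nonneg_right (hB y hy) (abs_nonneg _)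

/-- the mean value function -/
def GG {N : ℕ} (Ω : Set (Euc N)) (u0 : Euc N → ℝ) (x : Euc N) (t : ℝ) : ℝ :=
  ∫ y in Ω, kap x t y * u0 y

theorem GG_deriv {N : ℕ} {Ω : Set (Euc N)} {U : Euc N → ℝ} {u : ℕ → Euc N → ℝ} {u0 : Euc N → ℝ}
    (hU : LocBdd Ω U) (hUm : AEStronglyMeasurable U (volume.restrict Ω))
    (hpos : ∀ u : Euc N → ℝ, TestFun Ω u → 0 ≤ QB Ω U u u)
    (hu : ∀ k, TestFun Ω (u k)) (hQ : Tendsto (fun k => QB Ω U (u k) (u k)) atTop (𝓝 0))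
    (hu0 : ∀ K : Set (Euc N), IsCompact K → K ⊆ Ω → IntegrableOn u0 K)
    (hL1 : ∀ K : Set (Euc N), IsCompact K → K ⊆ Ω → Tendsto (fun k => ∫ x in K, |u k x - u0 x|) atTop (𝓝 0))
    {x : Euc N} {T t0 : ℝ} (ht0 : 0 < t0) (htT : t0 < T) (hball : Metric.closedBall x T ⊆ Ω) :
    HasDerivAt (GG Ω u0 x) (- ∫ y in Ω, U y * psi x t0 y * u0 y) t0 := by
  obtain ⟨R, hR, hR'⟩ := rh_bdd (N := N)
  set K := Metric.closedBall x T with hKdef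
  have hK : IsCompact K := isCompact_closedBall x T
  obtain ⟨a, ha⟩ := hU K hK hball
  have hxK : x ∈ K := Metric.mem_closedBall_self (by linarith)
  have ha0 : 0 ≤ a := (abs_nonneg _).trans (ha x hxK)
  set s := t0 / 2 with hs
  have hs0 : 0 < s := by positivity
  set B := (s ^ N)⁻¹ * R with hBdef
  have hB0 : 0 ≤ B := by positivity
  have hsub : ∀ t, t < T → Metric.closedBall x t ⊆ K := fun t ht => Metric.closedBall_subset_closedBall ht.le
  have hkB : ∀ t, s < t → ∀ y, kap x t y ≤ B := fun t ht y => kap_le hs0 ht.le hR' y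
  have hpB : ∀ t, s < t → t < T → ∀ y, |psi x t y| ≤ T * B := fun t ht htT y => by
    have h1 := abs_psi_le (x := x) (hs0.trans ht) y
    have h2 := hkB t ht y
    have h3 := kap_nonneg (x := x) (hs0.trans ht) y
    have h4 : 0 < t := hs0.trans ht
    calc _ ≤ t / 2 * kap x t y := h1
      _ ≤ T * B := by
        apply mul_le_mul <;> linarith
  have hk0 : ∀ t, s < t → t < T → ∀ y, y ∉ K → kap x t y = 0 := fun t ht htT y hy =>
    kap_zero (hs0.trans ht) (fun h => hy (hsub t htT h))
  have hp0 : ∀ t, s < t → t < T → ∀ y, y ∉ K → psi x t y = 0 := fun t ht htT y hy =>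
    psi_zero (hs0.trans ht) (fun h => hy (hsub t htT h))
  have hpT : ∀ t, s < t → t < T → TestFun Ω (psi x t) := fun t ht htT =>
    psi_test (hs0.trans ht) ((hsub t htT).trans hball)
  have hUp : ∀ t, s < t → t < T → AEStronglyMeasurable (fun y => U y * psi x t y) (volume.restrict Ω) :=
    fun t ht htT => hUm.mul (hpT t ht htT).cont.aestronglyMeasurable
  have hUpB : ∀ t, s < t → t < T → ∀ y ∈ K, |U y * psi x t y| ≤ a * (T * B) := fun t ht htT y hy => by
    rw [abs_mul]
    exact mul_le_mul (ha y hy) (hpB t ht htT y) (abs_nonneg _) ha0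
  -- energy bound of psi
  set Λ := (∫ y in K, (B ^ 2 + a * (T * B) ^ 2)) with hΛ
  have hE : ∀ t, s < t → t < T → QB Ω U (psi x t) (psi x t) ≤ Λ := fun t ht htT => by
    have hT := hpT t ht htT
    unfold QB
    rw [integral_shrink hball (fun y hy => by
      have h1 := psi_grad_norm (x := x) (hs0.trans ht) y
      rw [hk0 t ht htT y hy, norm_le_zero_iff] at h1
      rw [h1, hp0 t ht htT y hy]; simp)]
    · refine setIntegral_mono_on ((QB_integrable hU hUm hT hT).mono_set hball) (by simp [hK.measure_lt_top]) hK.measurableSet ?_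
      intro y hy
      rw [real_inner_self_eq_norm_sq]
      have h1 := (psi_grad_norm (x := x) (hs0.trans ht) y).trans (hkB t ht y)
      have h2 := hpB t ht htT y
      have h3 := (le_abs_self _).trans (ha y hy)
      have h4 : psi x t y * psi x t y ≤ (T * B) ^ 2 := by
        rw [← abs_mul_abs_self, sq]
        exact mul_self_le_mul_self (abs_nonneg _) h2
      have h5 : U y * (psi x t y * psi x t y) ≤ a * (T * B) ^ 2 :=
        mul_le_mul h3 h4 (mul_self_nonneg _) ha0
      have h6 : ‖gradient (psi x t) y‖ ^ 2 ≤ B ^ 2 := by gcongr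
      linarith
  have hsΩ : ∀ k t, s < t → t < T → (∫ y in Ω, kap x t y * u k y) = ∫ y, kap x t y * u k y := fun k t ht htT => by
    refine integral_eq_of_tsupport fun y hy => ?_
    rw [hk0 t ht htT y (fun h => hy (hball h)), zero_mul]
  have hlim0 := hL1 K hK hball
  have hsq : Tendsto (fun k => √(QB Ω U (u k) (u k)) * √Λ + a * (T * B) * ∫ y in K, |u k y - u0 y|) atTop (𝓝 0) := by
    have h1 := ((Real.continuous_sqrt.tendsto 0).comp hQ).mul_const (√Λ)
    have h2 := hlim0.const_mul (a * (T * B))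
    have := h1.add h2
    simpa using this
  refine hasDerivAt_of_tendstoUniformlyOn (l := atTop) (s := Set.Ioo s T) (isOpen_Ioo)
    (f := fun k t => ∫ y in Ω, kap x t y * u k y)
    (f' := fun k t => ∫ y, inner ℝ (gradient (u k) y) (gradient (psi x t) y))
    (g' := fun t => - ∫ y in Ω, U y * psi x t y * u0 y) ?_ ?_ ?_ ⟨by simp [hs]; linarith, htT⟩
  · rw [Metric.tendstoUniformlyOn_iff]
    intro ε hε
    filter_upwards [(tendsto_order.1 hsq).2 ε hε] with k hk t ht
    refine lt_of_le_of_lt ?_ hk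
    have hT := hpT t ht.1 ht.2
    have h1 := QB_cs hU hUm hpos (hu k) hT
    have h2 := QB_eq hU hUm (hu k) hT
    have h3 : (∫ y in Ω, inner ℝ (gradient (u k) y) (gradient (psi x t) y)) =
        ∫ y, inner ℝ (gradient (u k) y) (gradient (psi x t) y) := by
      refine integral_eq_of_tsupport fun y hy => ?_
      rw [grad_tsupport (fun h => hy (hT.2.2 h)), inner_zero_right]
    have h4 := lim_bound (hUp t ht.1 ht.2) hK hball (hUpB t ht.1 ht.2)
      (fun y hy => by rw [hp0 t ht.1 ht.2 y hy, mul_zero]) (hu0 K hK hball) (hu k).cont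
    have h5 : ∫ y in Ω, U y * (u k y * psi x t y) = ∫ y in Ω, U y * psi x t y * u k y := by
      congr 1; ext y; ring
    have h6 : √(QB Ω U (psi x t) (psi x t)) ≤ √Λ := Real.sqrt_le_sqrt (hE t ht.1 ht.2)
    have h7 : |QB Ω U (u k) (psi x t)| ≤ √(QB Ω U (u k) (u k)) * √Λ :=
      h1.trans (mul_le_mul_of_nonneg_left h6 (Real.sqrt_nonneg _))
    rw [h3, h5] at h2
    rw [Real.dist_eq, abs_sub_comm]
    have e : (∫ y, inner ℝ (gradient (u k) y) (gradient (psi x t) y)) - (- ∫ y in Ω, U y * psi x t y * u0 y) =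
      QB Ω U (u k) (psi x t) - ((∫ y in Ω, U y * psi x t y * u k y) - ∫ y in Ω, U y * psi x t y * u0 y) := by
      rw [h2]; ring
    rw [e]
    exact (abs_sub _ _).trans (add_le_add h7 h4)
  · refine Eventually.of_forall fun k t ht => ?_
    refine (kap_deriv (hu k) x (hs0.trans ht.1)).congr_of_eventuallyEq ?_
    filter_upwards [isOpen_Ioo.mem_nhds ht] with t' ht'
    exact hsΩ k t' ht'.1 ht'.2
  · intro t ht
    rw [tendsto_iff_dist_tendsto_zero]
    have hz := hlim0.const_mul B
    rw [mul_zero] at hz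
    refine squeeze_zero (fun _ => dist_nonneg) (fun k => ?_) hz
    rw [Real.dist_eq]
    refine lim_bound (kap_cont x t).aestronglyMeasurable hK hball (fun y _ => ?_) (hk0 t ht.1 ht.2) (hu0 K hK hball) (hu k).cont
    rw [abs_of_nonneg (kap_nonneg (hs0.trans ht.1) y)]
    exact hkB t ht.1 y

def MeanVal {N : ℕ} (Ω : Set (Euc N)) (U u0 : Euc N → ℝ) : Prop :=
  ∀ (x : Euc N) (T t0 : ℝ), 0 < t0 → t0 < T → Metric.closedBall x T ⊆ Ω →
    HasDerivAt (GG Ω u0 x) (- ∫ y in Ω, U y * psi x t0 y * u0 y) t0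

theorem kap_mul_integrable {N : ℕ} {Ω : Set (Euc N)} {u0 : Euc N → ℝ}
    (hu0 : ∀ K : Set (Euc N), IsCompact K → K ⊆ Ω → IntegrableOn u0 K)
    {x : Euc N} {t : ℝ} (ht : 0 < t) (hball : Metric.closedBall x t ⊆ Ω) :
    IntegrableOn (fun y => kap x t y * u0 y) Ω := by
  obtain ⟨R, hR, hR'⟩ := rh_bdd (N := N)
  refine bmul_integrable (B := (t ^ N)⁻¹ * R) (kap_cont x t).aestronglyMeasurable (isCompact_closedBall x t) hball (fun y _ => ?_)
    (fun y hy => kap_zero ht hy) (hu0 _ (isCompact_closedBall x t) hball)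
  rw [abs_of_nonneg (kap_nonneg ht y)]
  exact kap_le ht le_rfl hR' y

theorem pot_psi_bound {N : ℕ} {Ω : Set (Euc N)} {U u0 : Euc N → ℝ}
    (hu0 : ∀ K : Set (Euc N), IsCompact K → K ⊆ Ω → IntegrableOn u0 K)
    (hnn : ∀ y, 0 ≤ u0 y) {x : Euc N} {t a : ℝ} (ht : 0 < t) (hball : Metric.closedBall x t ⊆ Ω)
    (ha : ∀ y ∈ Metric.closedBall x t, |U y| ≤ a) :
    |∫ y in Ω, U y * psi x t y * u0 y| ≤ a * t / 2 * GG Ω u0 x t := by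
  unfold GG
  rw [← integral_const_mul]
  refine norm_integral_le_of_norm_le (f := fun y => U y * psi x t y * u0 y) ((kap_mul_integrable hu0 ht hball).const_mul _) (Eventually.of_forall fun y => ?_)
  rw [norm_mul, norm_mul, Real.norm_of_nonneg (hnn y)]
  by_cases hy : y ∈ Metric.closedBall x t
  · have h1 := ha y hy
    have h2 := abs_psi_le (x := x) ht y
    have h3 : |U y| * |psi x t y| ≤ a * (t / 2 * kap x t y) :=
      mul_le_mul h1 h2 (abs_nonneg _) ((abs_nonneg _).trans h1)
    have := mul_le_mul_of_nonneg_right h3 (hnn y)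
    simp only [Real.norm_eq_abs]
    linarith
  · simp [psi_zero ht hy, kap_zero ht hy]

theorem GG_mono {N : ℕ} {Ω : Set (Euc N)} {U u0 : Euc N → ℝ} (hMV : MeanVal Ω U u0)
    (hu0 : ∀ K : Set (Euc N), IsCompact K → K ⊆ Ω → IntegrableOn u0 K)
    (hnn : ∀ y, 0 ≤ u0 y) {x : Euc N} {T a : ℝ} (ha0 : 0 ≤ a) (hball : Metric.closedBall x T ⊆ Ω)
    (ha : ∀ y ∈ Metric.closedBall x T, |U y| ≤ a) {s t : ℝ} (hs : 0 < s) (hst : s ≤ t) (htT : t < T) :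
    GG Ω u0 x s ≤ Real.exp (a * t ^ 2 / 4) * GG Ω u0 x t := by
  have hd : ∀ t ∈ Set.Ioo 0 T, HasDerivAt (fun t => Real.exp (a * t ^ 2 / 4) * GG Ω u0 x t)
      (Real.exp (a * t ^ 2 / 4) * (a * t / 2) * GG Ω u0 x t +
        Real.exp (a * t ^ 2 / 4) * (- ∫ y in Ω, U y * psi x t y * u0 y)) t := by
    intro t ht
    have h1 : HasDerivAt (fun t : ℝ => Real.exp (a * t ^ 2 / 4)) (Real.exp (a * t ^ 2 / 4) * (a * t / 2)) t := by
      have := (((hasDerivAt_pow 2 t).const_mul a).div_const 4).exp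
      convert this using 2
      push_cast; ring
    exact h1.mul (hMV x T t ht.1 ht.2 hball)
  have hm : MonotoneOn (fun t => Real.exp (a * t ^ 2 / 4) * GG Ω u0 x t) (Set.Ioo 0 T) := by
    refine monotoneOn_of_deriv_nonneg (convex_Ioo _ _) (fun t ht => (hd t ht).continuousAt.continuousWithinAt) ?_ ?_
    · intro t ht
      rw [interior_Ioo] at ht
      exact (hd t ht).differentiableAt.differentiableWithinAt
    · intro t ht
      rw [interior_Ioo] at ht
      rw [(hd t ht).deriv]
      have hsub := Metric.closedBall_subset_closedBall (x := x) ht.2.le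
      have h2 := (le_abs_self _).trans (pot_psi_bound hu0 hnn ht.1 (hsub.trans hball) (fun y hy => ha y (hsub hy)))
      have h3 := Real.exp_pos (a * t ^ 2 / 4)
      rw [mul_assoc, ← mul_add]
      exact mul_nonneg h3.le (by linarith)
  have h1 := hm ⟨hs, hst.trans_lt htT⟩ ⟨hs.trans_le hst, htT⟩ hst
  have h2 : 1 ≤ Real.exp (a * s ^ 2 / 4) := Real.one_le_exp (by positivity)
  have h3 : 0 ≤ GG Ω u0 x s := integral_nonneg fun y => mul_nonneg (kap_nonneg hs y) (hnn y)
  simp only at h1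
  nlinarith

theorem kap_total {N : ℕ} {x : Euc N} {t : ℝ} (ht : 0 < t) : ∫ y, kap x t y = ∫ z : Euc N, rh z := by
  have := kap_integral (x := x) ht (fun _ => 1)
  simpa using this

theorem GG_ae_lim {N : ℕ} {Ω K : Set (Euc N)} {u0 : Euc N → ℝ} (hK : IsCompact K) (hKΩ : K ⊆ Ω)
    (hu0 : ∀ K : Set (Euc N), IsCompact K → K ⊆ Ω → IntegrableOn u0 K) :
    ∀ᵐ x, x ∈ interior K → Tendsto (GG Ω u0 x) (𝓝[>] 0) (𝓝 ((∫ z : Euc N, rh z) * u0 x)) := by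
  obtain ⟨R, hR, hR'⟩ := rh_bdd (N := N)
  set f := K.indicator u0 with hf
  have hfi : Integrable f := (integrable_indicator_iff hK.measurableSet).2 (hu0 K hK hKΩ)
  filter_upwards [IsUnifLocDoublingMeasure.ae_tendsto_average_norm_sub volume hfi.locallyIntegrable 1] with x hx hxK
  obtain ⟨r, hr, hrK⟩ := Metric.isOpen_iff.1 isOpen_interior x hxK
  have hfx : f x = u0 x := by rw [hf, Set.indicator_of_mem (interior_subset hxK)]
  have h1 := hx (ι := ℝ) (l := 𝓝[>] 0) (fun _ => x) (fun t => t) tendsto_id (by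
    filter_upwards [self_mem_nhdsWithin] with t ht
    simp only [one_mul]
    exact Metric.mem_closedBall_self (le_of_lt ht))
  set b := volume.real (Metric.closedBall (0 : Euc N) 1) with hb
  have h2 := h1.const_mul (R * b)
  rw [mul_zero] at h2
  rw [tendsto_iff_dist_tendsto_zero]
  refine squeeze_zero' (Eventually.of_forall fun _ => dist_nonneg) ?_ h2
  have hev : ∀ᶠ t in 𝓝[>] (0:ℝ), t < r := mem_nhdsWithin_of_mem_nhds (Iio_mem_nhds hr)
  filter_upwards [self_mem_nhdsWithin, hev] with t ht htr
  have ht : 0 < t := ht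
  have hsub : Metric.closedBall x t ⊆ K := (Metric.closedBall_subset_ball htr).trans (hrK.trans interior_subset)
  have hkc : HasCompactSupport (kap x t) :=
    HasCompactSupport.intro (isCompact_closedBall x t) (fun y hy => kap_zero ht hy)
  have e1 : GG Ω u0 x t = ∫ y, kap x t y * f y := by
    unfold GG
    rw [integral_eq_of_tsupport (fun y hy => by
      rw [kap_zero ht (fun h => hy (hKΩ (hsub h))), zero_mul])]
    congr 1; ext y
    by_cases hy : y ∈ K
    · rw [hf, Set.indicator_of_mem hy]
    · rw [kap_zero ht (fun h => hy (hsub h)), zero_mul, zero_mul]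
  have i1 : Integrable (fun y => kap x t y * f y) :=
    Integrable.bdd_mul (c := (t ^ N)⁻¹ * R) hfi (kap_cont x t).aestronglyMeasurable (Eventually.of_forall fun y => by
      rw [Real.norm_of_nonneg (kap_nonneg ht y)]; exact kap_le ht le_rfl hR' y)
  have i2 : Integrable (fun y => kap x t y * f x) :=
    ((kap_cont x t).integrable_of_hasCompactSupport hkc).mul_const _
  rw [Real.dist_eq, e1, ← kap_total (x := x) ht, ← hfx, ← integral_mul_const, ← integral_sub i1 i2]
  have e2 : ∀ y, kap x t y * f y - kap x t y * f x = kap x t y * (f y - f x) := fun y => by ring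
  simp only [e2]
  rw [← integral_eq_of_tsupport (Ω := Metric.closedBall x t) (fun y hy => by rw [kap_zero ht hy, zero_mul])]
  rw [setAverage_eq, Measure.addHaar_real_closedBall' _ _ ht.le]
  have hbpos : 0 < b := by
    rw [hb, measureReal_def]
    exact ENNReal.toReal_pos (Metric.measure_closedBall_pos _ _ one_pos).ne' (isCompact_closedBall _ _).measure_lt_top.ne
  have hNr : Module.finrank ℝ (Euc N) = N := by simp
  rw [hNr, smul_eq_mul]
  have e3 : R * b * ((t ^ N * b)⁻¹ * ∫ y in Metric.closedBall x t, ‖f y - f x‖) =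
      ∫ y in Metric.closedBall x t, (t ^ N)⁻¹ * R * ‖f y - f x‖ := by
    rw [integral_const_mul]
    field_simp
  rw [← hb, e3]
  refine norm_integral_le_of_norm_le (f := fun y => kap x t y * (f y - f x)) ?_ (Eventually.of_forall fun y => ?_)
  · refine Integrable.const_mul ?_ _
    refine (hfi.integrableOn.sub ?_).norm
    exact integrableOn_const (isCompact_closedBall x t).measure_lt_top.ne
  · rw [norm_mul, Real.norm_of_nonneg (kap_nonneg ht y)]
    exact mul_le_mul_of_nonneg_right (kap_le ht le_rfl hR' y) (norm_nonneg _)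

theorem local_bound {N : ℕ} {Ω : Set (Euc N)} {U u0 : Euc N → ℝ} (hΩ : IsOpen Ω) (hU : LocBdd Ω U)
    (hMV : MeanVal Ω U u0)
    (hu0 : ∀ K : Set (Euc N), IsCompact K → K ⊆ Ω → IntegrableOn u0 K)
    (hnn : ∀ y, 0 ≤ u0 y) {x0 : Euc N} (hx0 : x0 ∈ Ω) :
    ∃ r : ℝ, 0 < r ∧ Metric.closedBall x0 r ⊆ Ω ∧ ∃ M : ℝ, 0 ≤ M ∧ (∀ᵐ x, x ∈ Metric.ball x0 r → u0 x ≤ M) ∧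
      ∀ᵐ x, x ∈ Metric.ball x0 r → Tendsto (GG Ω u0 x) (𝓝[>] 0) (𝓝 ((∫ z : Euc N, rh z) * u0 x)) := by
  obtain ⟨R, hR, hR'⟩ := rh_bdd (N := N)
  obtain ⟨ε, hε, hεΩ⟩ := Metric.nhds_basis_closedBall.mem_iff.1 (hΩ.mem_nhds hx0)
  set r := ε / 3 with hr
  have hr0 : 0 < r := by positivity
  set K := Metric.closedBall x0 ε with hKdef
  have hK : IsCompact K := isCompact_closedBall _ _
  obtain ⟨a, ha⟩ := hU K hK hεΩ
  have ha0 : 0 ≤ a := (abs_nonneg _).trans (ha x0 (Metric.mem_closedBall_self hε.le))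
  set c := ∫ z : Euc N, rh z with hc
  have hcpos : 0 < c := rh_int_pos
  have hlim := GG_ae_lim hK hεΩ hu0
  have hrint : Metric.ball x0 r ⊆ interior K :=
    (Metric.ball_subset_ball (by linarith : r ≤ ε)).trans Metric.ball_subset_interior_closedBall
  have hI : 0 ≤ ∫ y in K, u0 y := integral_nonneg hnn
  set M1 := Real.exp (a * r ^ 2 / 4) * ((r ^ N)⁻¹ * R * ∫ y in K, u0 y) with hM1
  refine ⟨r, hr0, (Metric.closedBall_subset_closedBall (by linarith)).trans hεΩ, M1 / c, by positivity, ?_, ?_⟩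
  · filter_upwards [hlim] with x hx hxr
    have h1 := hx (hrint hxr)
    rw [le_div_iff₀ hcpos, mul_comm]
    refine le_of_tendsto h1 ?_
    have hev : ∀ᶠ t in 𝓝[>] (0:ℝ), t < r := mem_nhdsWithin_of_mem_nhds (Iio_mem_nhds hr0)
    filter_upwards [self_mem_nhdsWithin, hev] with t ht htr
    have hb2 : Metric.closedBall x (2 * r) ⊆ K := by
      refine Metric.closedBall_subset_closedBall' ?_
      have : dist x x0 < r := hxr
      linarith
    refine (GG_mono hMV hu0 hnn ha0 (hb2.trans hεΩ) (fun y hy => ha y (hb2 hy)) ht htr.le (by linarith)).trans ?_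
    refine mul_le_mul_of_nonneg_left ?_ (Real.exp_pos _).le
    have hbr : Metric.closedBall x r ⊆ K := (Metric.closedBall_subset_closedBall (by linarith)).trans hb2
    unfold GG
    rw [integral_shrink hεΩ (fun y hy => by rw [kap_zero hr0 (fun h => hy (hbr h)), zero_mul]), ← integral_const_mul]
    refine setIntegral_mono_on ((kap_mul_integrable hu0 hr0 (hbr.trans hεΩ)).mono_set hεΩ) ((hu0 K hK hεΩ).const_mul _) hK.measurableSet ?_
    intro y _
    exact mul_le_mul_of_nonneg_right (kap_le hr0 le_rfl hR' y) (hnn y)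
  · filter_upwards [hlim] with x hx hxr using hx (hrint hxr)

/-- gradient kernel -/
def kv {N : ℕ} (x : Euc N) (t : ℝ) (y : Euc N) : Euc N := kap x t y • t⁻¹ • (x - y)

theorem kv_norm {N : ℕ} {x : Euc N} {t : ℝ} (ht : 0 < t) (y : Euc N) : ‖kv x t y‖ ≤ kap x t y := by
  have := psi_grad_norm (x := x) ht y
  rwa [psi_grad ht, norm_neg] at this

theorem psi_fderiv_x {N : ℕ} {x y : Euc N} {t : ℝ} (ht : 0 < t) :
    HasFDerivAt (fun x => psi x t y) (InnerProductSpace.toDual ℝ (Euc N) (kv x t y)) x := by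
  have h1 : HasFDerivAt (fun x : Euc N => t⁻¹ • (x - y)) (t⁻¹ • (ContinuousLinearMap.id ℝ (Euc N))) x :=
    ((hasFDerivAt_id x).sub_const y).const_smul t⁻¹
  have h2 := (((sg_grad (t⁻¹ • (x - y))).hasFDerivAt.comp x h1).const_mul (t * (t ^ N)⁻¹))
  refine h2.congr_fderiv ?_
  ext v
  simp [kv, kap, InnerProductSpace.toDual_apply_apply]
  field_simp

theorem kap_meas {N : ℕ} (x : Euc N) : Measurable (fun p : ℝ × Euc N => kap x p.1 p.2) := by
  unfold kap
  exact ((measurable_fst.pow_const N).inv).mul (rh_cont.measurable.comp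
    (measurable_fst.inv.smul (measurable_const.sub measurable_snd)))

theorem psi_meas {N : ℕ} (x : Euc N) : Measurable (fun p : ℝ × Euc N => psi x p.1 p.2) := by
  unfold psi
  exact (measurable_fst.mul (measurable_fst.pow_const N).inv).mul (sg_cont.measurable.comp
    (measurable_fst.inv.smul (measurable_const.sub measurable_snd)))

theorem kv_meas {N : ℕ} (x : Euc N) : Measurable (fun p : ℝ × Euc N => kv x p.1 p.2) := by
  unfold kv
  exact (kap_meas x).smul (measurable_fst.inv.smul (measurable_const.sub measurable_snd))

theorem kap_integrable {N : ℕ} {x : Euc N} {t : ℝ} (ht : 0 < t) : Integrable (kap x t) :=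
  (kap_cont x t).integrable_of_hasCompactSupport
    (HasCompactSupport.intro (isCompact_closedBall x t) (fun _ hy => kap_zero ht hy))

section potential
variable {N : ℕ} {f : Euc N → ℝ} {M : ℝ}

def hh (f : Euc N → ℝ) (x : Euc N) (t : ℝ) : ℝ := ∫ y, f y * psi x t y
def hv (f : Euc N → ℝ) (x : Euc N) (t : ℝ) : Euc N := ∫ y, f y • kv x t y

theorem hh_bound (hM : ∀ y, |f y| ≤ M) {x : Euc N} {t : ℝ} (ht : 0 < t) :
    |hh f x t| ≤ M * (t / 2) * ∫ z : Euc N, rh z := by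
  unfold hh
  rw [← kap_total (x := x) ht, ← integral_const_mul]
  refine norm_integral_le_of_norm_le (f := fun y => f y * psi x t y) ((kap_integrable ht).const_mul _) (Eventually.of_forall fun y => ?_)
  rw [norm_mul, mul_assoc]
  exact mul_le_mul (hM y) (abs_psi_le ht y) (abs_nonneg _) ((abs_nonneg _).trans (hM y))

theorem hv_bound (hM : ∀ y, |f y| ≤ M) {x : Euc N} {t : ℝ} (ht : 0 < t) :
    ‖hv f x t‖ ≤ M * ∫ z : Euc N, rh z := by
  unfold hv
  rw [← kap_total (x := x) ht, ← integral_const_mul]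
  refine norm_integral_le_of_norm_le (f := fun y => f y • kv x t y) ((kap_integrable ht).const_mul _) (Eventually.of_forall fun y => ?_)
  rw [norm_smul]
  exact mul_le_mul (hM y) (kv_norm ht y) (norm_nonneg _) ((abs_nonneg _).trans (hM y))

theorem hh_meas (hf : Measurable f) (x : Euc N) : StronglyMeasurable (hh f x) := by
  unfold hh
  refine StronglyMeasurable.integral_prod_right (f := fun t y => f y * psi x t y) ?_
  exact ((hf.comp measurable_snd).mul (psi_meas x)).stronglyMeasurable

theorem hv_meas (hf : Measurable f) (x : Euc N) : StronglyMeasurable (hv f x) := by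
  unfold hv
  refine StronglyMeasurable.integral_prod_right (f := fun t y => f y • kv x t y) ?_
  exact ((hf.comp measurable_snd).smul (kv_meas x)).stronglyMeasurable

theorem kv_cont {t : ℝ} (y : Euc N) : Continuous (fun x => kv x t y) := by
  unfold kv kap
  exact (continuous_const.mul (rh_cont.comp (by fun_prop))).smul (by fun_prop)

theorem hv_cont (hf : Measurable f) (hfi : Integrable f) {t : ℝ} (ht : 0 < t) : Continuous (fun x => hv f x t) := by
  obtain ⟨R, hR, hR'⟩ := rh_bdd (N := N)
  unfold hv
  refine continuous_of_dominated (bound := fun y => ‖f y‖ * ((t ^ N)⁻¹ * R)) ?_ ?_ (hfi.norm.mul_const _) ?_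
  · intro x
    exact (hf.smul ((kv_meas x).comp (measurable_prodMk_left (x := t)))).aestronglyMeasurable
  · intro x
    refine Eventually.of_forall fun y => ?_
    rw [norm_smul]
    exact mul_le_mul_of_nonneg_left ((kv_norm ht y).trans (kap_le ht le_rfl hR' y)) (norm_nonneg _)
  · exact Eventually.of_forall fun y => (kv_cont y).const_smul (f y)

theorem hh_fderiv (hf : Measurable f) (hfi : Integrable f) {t : ℝ} (ht : 0 < t) (x : Euc N) :
    HasFDerivAt (fun x => hh f x t) (InnerProductSpace.toDual ℝ (Euc N) (hv f x t)) x := by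
  obtain ⟨R, hR, hR'⟩ := rh_bdd (N := N)
  have hkvm : ∀ x : Euc N, Measurable (fun y : Euc N => kv x t y) := fun x => (kv_meas x).comp (measurable_prodMk_left (x := t))
  have hpm : ∀ x : Euc N, Measurable (fun y : Euc N => psi x t y) := fun x => (psi_contDiff x t).continuous.measurable
  have hbv : ∀ x y, ‖f y • kv x t y‖ ≤ ‖f y‖ * ((t ^ N)⁻¹ * R) := fun x y => by
    rw [norm_smul]
    exact mul_le_mul_of_nonneg_left ((kv_norm ht y).trans (kap_le ht le_rfl hR' y)) (norm_nonneg _)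
  have hiv : Integrable (fun y => f y • kv x t y) :=
    Integrable.mono' (hfi.norm.mul_const _) (hf.smul (hkvm x)).aestronglyMeasurable (Eventually.of_forall (hbv x))
  have hih : Integrable (fun y => f y * psi x t y) := by
    refine Integrable.mono' (hfi.norm.mul_const (t / 2 * ((t ^ N)⁻¹ * R))) (hf.mul (hpm x)).aestronglyMeasurable (Eventually.of_forall fun y => ?_)
    rw [norm_mul]
    refine mul_le_mul_of_nonneg_left ((abs_psi_le ht y).trans ?_) (norm_nonneg _)
    exact mul_le_mul_of_nonneg_left (kap_le ht le_rfl hR' y) (by positivity)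
  have key := hasFDerivAt_integral_of_dominated_of_fderiv_le (μ := volume) (𝕜 := ℝ) (x₀ := x) (s := Set.univ)
    (F := fun x y => f y * psi x t y)
    (F' := fun x y => (InnerProductSpace.toDual ℝ (Euc N) (f y • kv x t y) : Euc N →L[ℝ] ℝ))
    (bound := fun y => ‖f y‖ * ((t ^ N)⁻¹ * R)) univ_mem
    (Eventually.of_forall fun x => (hf.mul (hpm x)).aestronglyMeasurable) hih
    ((InnerProductSpace.toDual ℝ (Euc N)).continuous.comp_aestronglyMeasurable hiv.1)
    (Eventually.of_forall fun y x _ => by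
      rw [LinearIsometryEquiv.norm_map]; exact hbv x y)
    (hfi.norm.mul_const _)
    (Eventually.of_forall fun y x _ => by
      have := (psi_fderiv_x (x := x) (y := y) ht).const_mul (f y)
      refine this.congr_fderiv ?_
      rw [map_smulₛₗ]
      rfl)
  refine key.congr_fderiv ?_
  unfold hv
  exact (InnerProductSpace.toDual ℝ (Euc N)).toContinuousLinearEquiv.toContinuousLinearMap.integral_comp_comm hiv

theorem pot_C1 (hf : Measurable f) (hfi : Integrable f) (hM : ∀ y, |f y| ≤ M) (ρ : ℝ) :
    ContDiff ℝ 1 (fun x => ∫ t in Set.Ioc 0 ρ, hh f x t) := by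
  set c := ∫ z : Euc N, rh z with hc
  have hcpos : 0 < c := rh_int_pos
  have hM0 : 0 ≤ M := (abs_nonneg _).trans (hM 0)
  have hfin : ∀ b : ℝ, Integrable (fun _ : ℝ => b) (volume.restrict (Set.Ioc 0 ρ)) := fun b =>
    integrableOn_const (by simp)
  have hiv : ∀ x, Integrable (fun t => hv f x t) (volume.restrict (Set.Ioc 0 ρ)) := fun x => by
    refine Integrable.mono' (hfin (M * c)) (hv_meas hf x).aestronglyMeasurable ?_
    filter_upwards [ae_restrict_mem measurableSet_Ioc] with t ht using hv_bound hM ht.1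
  have hih : ∀ x, Integrable (fun t => hh f x t) (volume.restrict (Set.Ioc 0 ρ)) := fun x => by
    refine Integrable.mono' (hfin (M * (ρ / 2) * c)) (hh_meas hf x).aestronglyMeasurable ?_
    filter_upwards [ae_restrict_mem measurableSet_Ioc] with t ht
    refine (hh_bound hM ht.1).trans ?_
    have := ht.2
    gcongr
  have hd : ∀ x, HasFDerivAt (fun x => ∫ t in Set.Ioc 0 ρ, hh f x t)
      (InnerProductSpace.toDual ℝ (Euc N) (∫ t in Set.Ioc 0 ρ, hv f x t)) x := by
    intro x
    have key := hasFDerivAt_integral_of_dominated_of_fderiv_le (μ := volume.restrict (Set.Ioc 0 ρ)) (𝕜 := ℝ) (x₀ := x) (s := Set.univ)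
      (F := fun x t => hh f x t)
      (F' := fun x t => (InnerProductSpace.toDual ℝ (Euc N) (hv f x t) : Euc N →L[ℝ] ℝ))
      (bound := fun _ => M * c) univ_mem
      (Eventually.of_forall fun x => (hh_meas hf x).aestronglyMeasurable) (hih x)
      ((InnerProductSpace.toDual ℝ (Euc N)).continuous.comp_aestronglyMeasurable (hiv x).1)
      (by
        filter_upwards [ae_restrict_mem measurableSet_Ioc] with t ht x _
        rw [LinearIsometryEquiv.norm_map]; exact hv_bound hM ht.1)
      (hfin _)
      (by
        filter_upwards [ae_restrict_mem measurableSet_Ioc] with t ht x _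
        exact hh_fderiv hf hfi ht.1 x)
    refine key.congr_fderiv ?_
    exact (InnerProductSpace.toDual ℝ (Euc N)).toContinuousLinearEquiv.toContinuousLinearMap.integral_comp_comm (hiv x)
  rw [contDiff_one_iff_hasFDerivAt]
  refine ⟨_, ?_, hd⟩
  refine (InnerProductSpace.toDual ℝ (Euc N)).continuous.comp ?_
  refine continuous_of_dominated (bound := fun _ => M * c) (fun x => (hiv x).1) (fun x => ?_) (hfin _) ?_
  · filter_upwards [ae_restrict_mem measurableSet_Ioc] with t ht using hv_bound hM ht.1
  · filter_upwards [ae_restrict_mem measurableSet_Ioc] with t ht using hv_cont hf hfi ht.1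

end potential

theorem kap_C1 {N : ℕ} {f : Euc N → ℝ} (hf : Integrable f) (ρ : ℝ) (hρ : 0 < ρ) :
    ContDiff ℝ 1 (fun x => ∫ y, kap x ρ y * f y) := by
  have h1 : HasCompactSupport (fun w : Euc N => (ρ ^ N)⁻¹ * rh (ρ⁻¹ • w)) := by
    refine HasCompactSupport.intro (isCompact_closedBall 0 ρ) (fun w hw => ?_)
    have := norm_scale (x := w) (y := 0) hρ (by simpa [dist_comm] using hw)
    rw [sub_zero] at this
    rw [rh_zero this, mul_zero]
  have h2 : ContDiff ℝ 1 (fun w : Euc N => (ρ ^ N)⁻¹ * rh (ρ⁻¹ • w)) :=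
    (contDiff_const.mul (rh_contDiff.comp (by fun_prop))).of_le (by exact_mod_cast le_top)
  have h3 := h1.contDiff_convolution_right (n := 1) (ContinuousLinearMap.mul ℝ ℝ) (μ := volume) hf.locallyIntegrable h2
  have e : (fun x : Euc N => ∫ y, kap x ρ y * f y) =
      convolution f (fun w => (ρ ^ N)⁻¹ * rh (ρ⁻¹ • w)) (ContinuousLinearMap.mul ℝ ℝ) volume := by
    funext x
    rw [convolution_def]
    congr 1; ext y
    simp [kap]
    ring
  rw [e]
  exact_mod_cast h3

theorem local_reg {N : ℕ} {Ω : Set (Euc N)} {U u0 : Euc N → ℝ} (hΩ : IsOpen Ω) (hU : LocBdd Ω U)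
    (hUm : AEStronglyMeasurable U (volume.restrict Ω))
    (hMV : MeanVal Ω U u0)
    (hu0 : ∀ K : Set (Euc N), IsCompact K → K ⊆ Ω → IntegrableOn u0 K)
    (hnn : ∀ y, 0 ≤ u0 y) {x0 : Euc N} (hx0 : x0 ∈ Ω) :
    ∃ δ : ℝ, 0 < δ ∧ ∃ Φ : Euc N → ℝ, ContDiff ℝ 1 Φ ∧
      (∀ x ∈ Metric.ball x0 δ, Tendsto (GG Ω u0 x) (𝓝[>] 0) (𝓝 (Φ x))) ∧
      ∀ᵐ x, x ∈ Metric.ball x0 δ → Φ x = (∫ z : Euc N, rh z) * u0 x := by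
  obtain ⟨r, hr, hrΩ, M, hM, hM1, hM2⟩ := local_bound hΩ hU hMV hu0 hnn hx0
  have hK := isCompact_closedBall x0 r
  obtain ⟨a, ha⟩ := hU _ hK hrΩ
  have ha0 : 0 ≤ a := (abs_nonneg _).trans (ha x0 (Metric.mem_closedBall_self hr.le))
  have hbK : Metric.ball x0 r ⊆ Metric.closedBall x0 r := Metric.ball_subset_closedBall
  have hui : IntegrableOn u0 (Metric.ball x0 r) := (hu0 _ hK hrΩ).mono_set hbK
  have hgi : IntegrableOn (fun y => U y * u0 y) (Metric.ball x0 r) := by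
    refine Integrable.mono' (hui.norm.const_mul a) ((hUm.mono_measure (Measure.restrict_mono (hbK.trans hrΩ) le_rfl)).mul hui.1) ?_
    filter_upwards [ae_restrict_mem measurableSet_ball] with y hy
    rw [norm_mul]
    exact mul_le_mul_of_nonneg_right (ha y (hbK hy)) (norm_nonneg _)
  set g : Euc N → ℝ := (Metric.ball x0 r).indicator (fun y => U y * u0 y) with hg
  have hgI : Integrable g := hgi.integrable_indicator measurableSet_ball
  set f1 : Euc N → ℝ := (Metric.ball x0 r).indicator u0 with hf1
  have hf1I : Integrable f1 := hui.integrable_indicator measurableSet_ball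
  set M' := a * M with hM'
  have hM'0 : 0 ≤ M' := by positivity
  set g0 := hgI.1.mk g with hg0
  have hg0m : Measurable g0 := hgI.1.stronglyMeasurable_mk.measurable
  set f : Euc N → ℝ := fun y => max (-M') (min M' (g0 y)) with hf
  have hfm : Measurable f := measurable_const.max (measurable_const.min hg0m)
  have hfM : ∀ y, |f y| ≤ M' := fun y => by
    rw [abs_le]
    exact ⟨le_max_left _ _, max_le (by linarith) (min_le_left _ _)⟩
  have hfg : f =ᵐ[volume] g := by
    filter_upwards [hgI.1.ae_eq_mk, hM1] with y hy hy2
    have hgy : |g y| ≤ M' := by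
      rw [hg]
      by_cases hyb : y ∈ Metric.ball x0 r
      · rw [Set.indicator_of_mem hyb, abs_mul, abs_of_nonneg (hnn y)]
        exact mul_le_mul (ha y (hbK hyb)) (hy2 hyb) (hnn y) ha0
      · rw [Set.indicator_of_notMem hyb, abs_zero]; exact hM'0
    have := abs_le.1 hgy
    show max (-M') (min M' (g0 y)) = g y
    rw [hg0, ← hy, min_eq_right this.2, max_eq_right this.1]
  have hfI : Integrable f := hgI.congr hfg.symm
  set ρ := r / 4 with hρ
  have hρ0 : 0 < ρ := by positivity
  set Φ : Euc N → ℝ := fun x => (∫ y, kap x ρ y * f1 y) + ∫ t in Set.Ioc 0 ρ, hh f x t with hΦ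
  have hlim : ∀ x ∈ Metric.ball x0 (r / 2), Tendsto (GG Ω u0 x) (𝓝[>] 0) (𝓝 (Φ x)) := by
    intro x hx
    have hsub : ∀ t, t < r / 2 → Metric.closedBall x t ⊆ Metric.ball x0 r := by
      intro t ht y hy
      rw [Metric.mem_ball] at hx ⊢
      rw [Metric.mem_closedBall] at hy
      linarith [dist_triangle y x x0]
    have hG : GG Ω u0 x ρ = ∫ y, kap x ρ y * f1 y := by
      unfold GG
      rw [← integral_indicator hΩ.measurableSet]
      congr 1; ext y
      by_cases hy : y ∈ Metric.closedBall x ρ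
      · have h1 := hsub ρ (by rw [hρ]; linarith) hy
        rw [Set.indicator_of_mem (hrΩ (hbK h1)), hf1, Set.indicator_of_mem h1]
      · simp [Set.indicator_apply, kap_zero hρ0 hy]
    have hh_eq : ∀ t, 0 < t → t < r / 2 → ∫ y in Ω, U y * psi x t y * u0 y = hh f x t := by
      intro t ht0 ht
      unfold hh
      rw [← integral_indicator hΩ.measurableSet]
      refine integral_congr_ae ?_
      filter_upwards [hfg] with y hfy
      rw [hfy]
      by_cases hy : y ∈ Metric.closedBall x t
      · have h1 := hsub t ht hy
        rw [Set.indicator_of_mem (hrΩ (hbK h1)), hg, Set.indicator_of_mem h1]; ring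
      · simp [Set.indicator_apply, psi_zero ht0 hy]
    have hIntg : IntegrableOn (hh f x) (Set.Ioc 0 ρ) := by
      refine Integrable.mono' (g := fun _ => M' * (ρ / 2) * ∫ z : Euc N, rh z) (integrableOn_const (by simp)) (hh_meas hfm x).aestronglyMeasurable ?_
      filter_upwards [ae_restrict_mem measurableSet_Ioc] with t ht
      refine (hh_bound hfM ht.1).trans ?_
      have := ht.2
      have := rh_int_pos (N := N)
      gcongr
    have hII : IntervalIntegrable (hh f x) volume 0 ρ := (intervalIntegrable_iff_integrableOn_Ioc_of_le hρ0.le).2 hIntg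
    have hftc : ∀ s ∈ Set.Ioc 0 ρ, GG Ω u0 x s = GG Ω u0 x ρ + ∫ t in s..ρ, hh f x t := by
      intro s hs
      have h1 := intervalIntegral.integral_eq_sub_of_hasDerivAt (f := GG Ω u0 x) (f' := fun t => - hh f x t) (a := s) (b := ρ)
        (fun t ht => by
          rw [Set.uIcc_of_le hs.2] at ht
          have ht1 : t < 3 * r / 8 := by have := ht.2; rw [hρ] at this; linarith
          have ht0 : 0 < t := hs.1.trans_le ht.1
          rw [← hh_eq t ht0 (by linarith)]
          exact hMV x (3 * r / 8) t ht0 ht1 ((hsub _ (by linarith)).trans (hbK.trans hrΩ)))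
        ((hII.mono_set (by rw [Set.uIcc_of_le hs.2, Set.uIcc_of_le hρ0.le]; exact Set.Icc_subset_Icc_left hs.1.le)).neg)
      rw [intervalIntegral.integral_neg] at h1
      linarith
    have hc : Tendsto (fun s => ∫ t in s..ρ, hh f x t) (𝓝[>] 0) (𝓝 (∫ t in (0:ℝ)..ρ, hh f x t)) := by
      have hcont : ContinuousOn (fun s => ∫ t in ρ..s, hh f x t) (Set.uIcc 0 ρ) :=
        intervalIntegral.continuousOn_primitive_interval' hII Set.right_mem_uIcc
      have h0 := (hcont 0 Set.left_mem_uIcc).neg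
      have h1 : Tendsto (fun s => - ∫ t in ρ..s, hh f x t) (𝓝[>] 0) (𝓝 (- ∫ t in ρ..0, hh f x t)) := by
        refine h0.mono_left ?_
        rw [Set.uIcc_of_le hρ0.le]
        exact nhdsWithin_le_of_mem (mem_of_superset (Ioc_mem_nhdsGT hρ0) Set.Ioc_subset_Icc_self)
      simpa only [← intervalIntegral.integral_symm] using h1
    rw [intervalIntegral.integral_of_le hρ0.le] at hc
    have h2 := hc.const_add (GG Ω u0 x ρ)
    rw [hG] at h2
    refine h2.congr' ?_
    filter_upwards [Ioc_mem_nhdsGT hρ0] with s hs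
    rw [hftc s hs, hG]
  refine ⟨r / 2, by positivity, Φ, (kap_C1 hf1I ρ hρ0).add (pot_C1 hfm hfI hfM ρ), hlim, ?_⟩
  filter_upwards [hM2] with x hx hxb
  exact tendsto_nhds_unique (hlim x hxb) (hx (Metric.ball_subset_ball (by linarith) hxb))

theorem regularity {N : ℕ} {Ω : Set (Euc N)} {U u0 : Euc N → ℝ} (hΩ : IsOpen Ω) (hU : LocBdd Ω U)
    (hUm : AEStronglyMeasurable U (volume.restrict Ω))
    (hMV : MeanVal Ω U u0)
    (hu0 : ∀ K : Set (Euc N), IsCompact K → K ⊆ Ω → IntegrableOn u0 K)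
    (hnn : ∀ y, 0 ≤ u0 y) :
    ∃ φ : Euc N → ℝ, ContDiffOn ℝ 1 φ Ω ∧ φ =ᵐ[volume.restrict Ω] u0 := by
  set c := ∫ z : Euc N, rh z with hc
  have hc0 : 0 < c := rh_int_pos
  set φ : Euc N → ℝ := fun x => limUnder (𝓝[>] 0) (GG Ω u0 x) / c with hφ
  refine ⟨φ, ?_, ?_⟩
  · intro x0 hx0
    obtain ⟨δ, hδ, Φ, hΦ, h1, -⟩ := local_reg hΩ hU hUm hMV hu0 hnn hx0
    have : ContDiffAt ℝ 1 φ x0 := by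
      refine (hΦ.div_const c).contDiffAt.congr_of_eventuallyEq ?_
      filter_upwards [Metric.ball_mem_nhds x0 hδ] with x hx
      rw [hφ]; simp only
      rw [(h1 x hx).limUnder_eq]
    exact this.contDiffWithinAt
  · rw [EventuallyEq, ae_iff, Measure.restrict_apply' hΩ.measurableSet]
    refine measure_null_of_locally_null _ ?_
    rintro x0 ⟨-, hx0⟩
    obtain ⟨δ, hδ, Φ, hΦ, h1, h2⟩ := local_reg hΩ hU hUm hMV hu0 hnn hx0
    refine ⟨Metric.ball x0 δ ∩ _, inter_mem (mem_nhdsWithin_of_mem_nhds (Metric.ball_mem_nhds x0 hδ)) self_mem_nhdsWithin, ?_⟩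
    refine measure_mono_null ?_ (ae_iff.1 h2)
    rintro x ⟨hxb, hx, -⟩
    simp only [Set.mem_setOf_eq] at hx ⊢
    intro hcon
    apply hx
    rw [hφ]; simp only
    rw [(h1 x hxb).limUnder_eq, hcon hxb, ← hc]
    exact mul_div_cancel_left₀ _ hc0.ne'

theorem L1_of_L2 {N : ℕ} {K : Set (Euc N)} (hK : IsCompact K) {g : ℕ → Euc N → ℝ}
    (hg : ∀ k, MemLp (g k) 2 (volume.restrict K))
    (h : Tendsto (fun k => ∫ x in K, (g k x) ^ 2) atTop (𝓝 0)) :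
    Tendsto (fun k => ∫ x in K, |g k x|) atTop (𝓝 0) := by
  haveI : IsFiniteMeasure (volume.restrict K) := ⟨by simpa using hK.measure_lt_top⟩
  set v := volume.real K with hv
  have hv0 : 0 ≤ v := measureReal_nonneg
  have key : ∀ δ > 0, ∀ k, ∫ x in K, |g k x| ≤ δ * v + (1 / δ) * ∫ x in K, (g k x) ^ 2 := by
    intro δ hδ k
    have e : δ * v + (1 / δ) * ∫ x in K, (g k x) ^ 2 = ∫ x in K, (δ + (1 / δ) * (g k x) ^ 2) := by
      rw [integral_add (integrable_const _) ((hg k).integrable_sq.const_mul _), integral_const_mul]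
      simp [hv, mul_comm]
    rw [e]
    refine integral_mono ((hg k).integrable (by norm_num)).abs ((integrable_const _).add ((hg k).integrable_sq.const_mul _)) (fun x => ?_)
    simp only
    have h1 : δ + 1 / δ * g k x ^ 2 - |g k x| = ((δ - |g k x|) ^ 2 + δ * |g k x|) / δ := by
      rw [← sq_abs (g k x)]; field_simp; ring
    have : 0 ≤ ((δ - |g k x|) ^ 2 + δ * |g k x|) / δ := by positivity
    linarith
  rw [Metric.tendsto_atTop] at h ⊢
  intro ε hε
  set δ := ε / (2 * (v + 1)) with hδ
  have hδ0 : 0 < δ := by positivity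
  obtain ⟨n, hn⟩ := h (δ * (ε / 2)) (by positivity)
  refine ⟨n, fun k hk => ?_⟩
  have h1 := hn k hk
  rw [Real.dist_eq, sub_zero] at h1 ⊢
  rw [abs_of_nonneg (integral_nonneg fun x => abs_nonneg _)]
  have h2 := (le_abs_self _).trans_lt h1
  have h3 := key δ hδ0 k
  have h4 : δ * v ≤ ε / 2 := by
    have : δ * (v + 1) = ε / 2 := by rw [hδ]; field_simp
    nlinarith
  have h5 : (1 / δ) * ∫ x in K, (g k x) ^ 2 < (1 / δ) * (δ * (ε / 2)) := mul_lt_mul_of_pos_left h2 (by positivity)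
  have h6 : (1 / δ) * (δ * (ε / 2)) = ε / 2 := by field_simp
  linarith

theorem core {N : ℕ} {Ω : Set (Euc N)} {U m : Euc N → ℝ} {u : ℕ → Euc N → ℝ} {A : ℝ}
    (hΩ : IsOpen Ω) (hU : LocBdd Ω U) (hUm : AEStronglyMeasurable U (volume.restrict Ω))
    (hpos : ∀ u : Euc N → ℝ, TestFun Ω u → 0 ≤ QB Ω U u u)
    (hm : ContinuousOn m Ω) (hmpos : ∀ x ∈ Ω, 0 < m x)
    (hu : ∀ k, TestFun Ω (u k)) (hunn : ∀ k x, 0 ≤ u k x)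
    (hA : ∀ k, ∫ x in Ω, m x * (u k x * u k x) ≤ A)
    (hQ : Tendsto (fun k => QB Ω U (u k) (u k)) atTop (𝓝 0)) :
    ∃ n : ℕ → ℕ, StrictMono n ∧ ∃ φ : Euc N → ℝ, ContDiffOn ℝ 1 φ Ω ∧
      ∀ K : Set (Euc N), IsCompact K → K ⊆ Ω →
        Tendsto (fun k => ∫ x in K, (u (n k) x - φ x) ^ 2) atTop (𝓝 0) := by
  obtain ⟨n, hn, u0, hu0m, hu0, hweak⟩ := weak_limit hΩ hm hmpos hu hA
  obtain ⟨B, hB⟩ := hQ.bddAbove_range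
  have hB' : ∀ k, QB Ω U (u k) (u k) ≤ B := fun k => hB ⟨k, rfl⟩
  have hst := strong_limit (u := fun k => u (n k)) hΩ hU hUm hpos hm hmpos (fun k => hu (n k)) (fun k => hA (n k))
    (fun k => hB' (n k)) hu0 hweak
  have hu0K : ∀ K : Set (Euc N), IsCompact K → K ⊆ Ω → MemLp u0 2 (volume.restrict K) := fun K hK hKΩ => by
    have := (memLp_indicator_iff_restrict hK.measurableSet).1 (hu0 K hK hKΩ)
    rwa [Measure.restrict_restrict_of_subset hKΩ] at this
  set w : Euc N → ℝ := fun x => |u0 x| with hw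
  have hwK : ∀ K : Set (Euc N), IsCompact K → K ⊆ Ω → MemLp w 2 (volume.restrict K) := fun K hK hKΩ =>
    (hu0K K hK hKΩ).abs
  have huK : ∀ k (K : Set (Euc N)), IsCompact K → MemLp (u (n k)) 2 (volume.restrict K) := fun k K hK =>
    ((hu (n k)).cont.memLp_of_hasCompactSupport (hu (n k)).2.1).mono_measure Measure.restrict_le_self
  have hst2 : ∀ K : Set (Euc N), IsCompact K → K ⊆ Ω →
      Tendsto (fun k => ∫ x in K, (u (n k) x - w x) ^ 2) atTop (𝓝 0) := by
    intro K hK hKΩ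
    refine squeeze_zero (fun k => integral_nonneg fun x => sq_nonneg _) (fun k => ?_) (hst K hK hKΩ)
    refine integral_mono ((huK k K hK).sub (hwK K hK hKΩ)).integrable_sq ((huK k K hK).sub (hu0K K hK hKΩ)).integrable_sq (fun x => ?_)
    have h1 := hunn (n k) x
    simp only [hw, Pi.sub_apply]
    rw [sq_le_sq]
    nth_rewrite 1 [← abs_of_nonneg h1]
    exact abs_abs_sub_abs_le _ _
  have hL1 : ∀ K : Set (Euc N), IsCompact K → K ⊆ Ω →
      Tendsto (fun k => ∫ x in K, |u (n k) x - w x|) atTop (𝓝 0) := fun K hK hKΩ =>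
    L1_of_L2 (g := fun k x => u (n k) x - w x) hK (fun k => (huK k K hK).sub (hwK K hK hKΩ)) (hst2 K hK hKΩ)
  have hwi : ∀ K : Set (Euc N), IsCompact K → K ⊆ Ω → IntegrableOn w K := fun K hK hKΩ => by
    haveI : IsFiniteMeasure (volume.restrict K) := ⟨by simpa using hK.measure_lt_top⟩
    exact (hwK K hK hKΩ).integrable (by norm_num)
  have hMV : MeanVal Ω U w := fun x T t0 h1 h2 h3 =>
    GG_deriv hU hUm hpos (fun k => hu (n k)) (hQ.comp hn.tendsto_atTop) hwi hL1 h1 h2 h3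
  obtain ⟨φ, hφ, hφe⟩ := regularity hΩ hU hUm hMV hwi (fun y => abs_nonneg _)
  refine ⟨n, hn, φ, hφ, fun K hK hKΩ => (hst2 K hK hKΩ).congr fun k => ?_⟩
  refine integral_congr_ae ?_
  filter_upwards [ae_restrict_of_ae_restrict_of_subset hKΩ hφe] with x hx
  rw [hx]

theorem exhaustion {N : ℕ} {Ω : Set (Euc N)} (hΩ : IsOpen Ω) :
    ∃ K : ℕ → Set (Euc N), (∀ n, IsCompact (K n)) ∧ (∀ n, K n ⊆ Ω) ∧ Monotone K ∧ ⋃ n, K n = Ω := by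
  obtain ⟨F, hF1, hF2, hF3, hF4⟩ := hΩ.exists_iUnion_isClosed
  refine ⟨fun n => F n ∩ Metric.closedBall 0 n, fun n => (isCompact_closedBall _ _).inter_left (hF1 n),
    fun n => Set.inter_subset_left.trans (hF2 n), fun a b hab => Set.inter_subset_inter (hF4 hab)
      (Metric.closedBall_subset_closedBall (by exact_mod_cast hab)), ?_⟩
  refine Set.Subset.antisymm (Set.iUnion_subset fun n => Set.inter_subset_left.trans (hF2 n)) ?_
  intro x hx
  rw [← hF3] at hx
  obtain ⟨a, ha⟩ := Set.mem_iUnion.1 hx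
  obtain ⟨b, hb⟩ := exists_nat_ge ‖x‖
  refine Set.mem_iUnion.2 ⟨max a b, hF4 (le_max_left a b) ha, ?_⟩
  rw [mem_closedBall_zero_iff]
  exact hb.trans (by exact_mod_cast le_max_right a b)

theorem meas_of_int {N : ℕ} {Ω : Set (Euc N)} (hΩ : IsOpen Ω) {U : Euc N → ℝ}
    (h : ∀ u : Euc N → ℝ, TestFun Ω u → (∀ x, 0 ≤ u x) → (∃ x, u x ≠ 0) →
      IntegrableOn (fun x => inner ℝ (gradient u x) (gradient u x) + U x * (u x * u x)) Ω) :
    AEStronglyMeasurable U (volume.restrict Ω) := by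
  obtain ⟨K, hK1, hK2, -, hK4⟩ := exhaustion hΩ
  rw [← hK4]
  refine AEStronglyMeasurable.iUnion fun n => ?_
  rcases (K n).eq_empty_or_nonempty with he | ⟨x, hx⟩
  · rw [he, Measure.restrict_empty]; exact aestronglyMeasurable_zero_measure _
  obtain ⟨η, hη, hη1, hη0, -⟩ := exists_cutoff hΩ (hK1 n) (hK2 n)
  have h1 := (h η hη hη0 ⟨x, by rw [hη1 x hx]; norm_num⟩).sub (grad_inner_integrable hη hη)
  have h2 := h1.1.mono_measure (Measure.restrict_mono (hK2 n) le_rfl)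
  refine h2.congr ?_
  filter_upwards [ae_restrict_mem (hK1 n).measurableSet] with y hy
  simp [hη1 y hy]

theorem W_integrable {N : ℕ} {Ω : Set (Euc N)} {W u : Euc N → ℝ} {p : ℝ} (hp : 0 < p)
    (hW : ContinuousOn W Ω) (hu : TestFun Ω u) : IntegrableOn (fun x => W x * |u x| ^ p) Ω := by
  refine integrableOn_of_zero_off hu.2.1 hu.2.2 ?_ (fun x hx => by
    simp [image_eq_zero_of_notMem_tsupport hx, Real.zero_rpow hp.ne'])
  exact ((hW.mono hu.2.2).mul (hu.cont.abs.rpow_const (fun x => Or.inr hp.le)).continuousOn).integrableOn_compact hu.2.1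

theorem W_pos {N : ℕ} {Ω : Set (Euc N)} {W u : Euc N → ℝ} {p : ℝ} (hp : 0 < p) (hΩ : IsOpen Ω)
    (hW : ContinuousOn W Ω) (hWpos : ∀ x ∈ Ω, 0 < W x) (hu : TestFun Ω u) (hne : ∃ x, u x ≠ 0) :
    0 < ∫ x in Ω, W x * |u x| ^ p := by
  rw [setIntegral_pos_iff_support_of_nonneg_ae _ (W_integrable hp hW hu)]
  · have hsub : Function.support u ⊆ Function.support (fun x => W x * |u x| ^ p) ∩ Ω := by
      intro x hx
      have hxΩ : x ∈ Ω := hu.2.2 (subset_tsupport u hx)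
      refine ⟨?_, hxΩ⟩
      rw [Function.mem_support] at hx ⊢
      exact (mul_pos (hWpos x hxΩ) (Real.rpow_pos_of_pos (abs_pos.2 hx) p)).ne'
    refine lt_of_lt_of_le ?_ (measure_mono hsub)
    exact (hu.cont.isOpen_support).measure_pos _ (hne.imp fun x hx => hx)
  · filter_upwards [ae_restrict_mem hΩ.measurableSet] with x hx
    exact mul_nonneg (hWpos x hx).le (Real.rpow_nonneg (abs_nonneg _) _)

theorem QB_smul {N : ℕ} {Ω : Set (Euc N)} {U u : Euc N → ℝ} (c : ℝ) (hu : TestFun Ω u) :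
    QB Ω U (fun x => c * u x) (fun x => c * u x) = c ^ 2 * QB Ω U u u := by
  unfold QB
  rw [← integral_const_mul]
  congr 1; ext x
  rw [grad_const_mul c (hu.diff x), inner_smul_left, inner_smul_right]
  simp; ring

/-- A nonnegative nonzero test function at zero level gives a ground state. -/
theorem gs_of_zero {N : ℕ} {Ω : Set (Euc N)} {U u : Euc N → ℝ} (hΩ : IsOpen Ω) (hu : TestFun Ω u)
    (hnn : ∀ x, 0 ≤ u x) (hne : ∃ x, u x ≠ 0) (hQ : QB Ω U u u = 0) : ∃ φ, IsGroundState Ω U 2 φ := by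
  obtain ⟨x0, hx0⟩ := hne
  have hx0Ω : x0 ∈ Ω := hu.2.2 (subset_tsupport u hx0)
  obtain ⟨r, hr, hrΩ⟩ := Metric.nhds_basis_closedBall.mem_iff.1 (hΩ.mem_nhds hx0Ω)
  have hcl : closure (Metric.ball x0 r) ⊆ Metric.closedBall x0 r := Metric.closure_ball_subset_closedBall
  have hIntg : IntegrableOn (fun x => (u x) ^ 2) (Metric.ball x0 r) :=
    ((hu.cont.pow 2).continuousOn.integrableOn_compact (isCompact_closedBall x0 r)).mono_set Metric.ball_subset_closedBall
  have hI : 0 < ∫ x in Metric.ball x0 r, (u x) ^ 2 := by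
    rw [setIntegral_pos_iff_support_of_nonneg_ae (Eventually.of_forall fun x => sq_nonneg _) hIntg]
    refine IsOpen.measure_pos _ ((hu.cont.pow 2).isOpen_support.inter Metric.isOpen_ball) ⟨x0, ?_, Metric.mem_ball_self hr⟩
    exact pow_ne_zero 2 hx0
  set I := ∫ x in Metric.ball x0 r, (u x) ^ 2 with hIdef
  set c := (√I)⁻¹ with hc
  have hc0 : 0 < c := by positivity
  refine ⟨fun x => c * u x, ((hu.const_mul c).1.of_le (by exact_mod_cast le_top)).contDiffOn, fun _ x => c * u x, Metric.ball x0 r,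
    Metric.isOpen_ball, ⟨x0, Metric.mem_ball_self hr⟩, (isCompact_closedBall x0 r).of_isClosed_subset isClosed_closure hcl,
    hcl.trans hrΩ, fun _ => ⟨hu.const_mul c, fun x => mul_nonneg hc0.le (hnn x)⟩, ?_, fun _ => ?_, fun K _ _ => ?_⟩
  · simp only [Qfun_eq_QB, QB_smul c hu, hQ, mul_zero]
    exact tendsto_const_nhds
  · have : ∀ x, |c * u x| ^ (2:ℝ) = c ^ 2 * (u x) ^ 2 := fun x => by
      rw [Real.rpow_two, sq_abs, mul_pow]
    simp only [this]
    rw [integral_const_mul, ← hIdef, hc, inv_pow, Real.sq_sqrt hI.le, inv_mul_cancel₀ hI.ne']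
  · simp

theorem meas_of_nogs {N : ℕ} {Ω : Set (Euc N)} {U : Euc N → ℝ} (hΩ : IsOpen Ω)
    (hnogs : ¬ ∃ φ : Euc N → ℝ, IsGroundState Ω U 2 φ) :
    AEStronglyMeasurable U (volume.restrict Ω) := by
  refine meas_of_int hΩ fun u hu hnn hne => ?_
  by_contra hcon
  exact hnogs (gs_of_zero hΩ hu hnn hne (integral_undef hcon))

theorem meas_of_HSM {N : ℕ} {Ω : Set (Euc N)} {V W : Euc N → ℝ} {p q : ℝ} (hp : 0 < p) (hΩ : IsOpen Ω)
    (hW : ContinuousOn W Ω) (hWpos : ∀ x ∈ Ω, 0 < W x)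
    (hHSM : ∀ u : Euc N → ℝ, TestFun Ω u →
      (∫ x in Ω, W x * |u x| ^ p) ^ q ≤ Qfun Ω V 2 u) :
    AEStronglyMeasurable V (volume.restrict Ω) := by
  refine meas_of_int hΩ fun u hu hnn hne => ?_
  by_contra hcon
  have h1 := hHSM u hu
  rw [Qfun_eq_QB, QB, integral_undef hcon] at h1
  exact absurd h1 (not_le.2 (Real.rpow_pos_of_pos (W_pos hp hΩ hW hWpos hu hne) q))

theorem pStar_val {N : ℕ} (hN : 2 < N) : (2:ℝ) < N ∧ 0 < pStar 2 N ∧ 2 / pStar 2 N = ((N:ℝ) - 2) / N ∧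
    pStar 2 N = 2 * ((N:ℝ) / (N - 2)) := by
  have h : (2:ℝ) < N := by exact_mod_cast hN
  have h2 : (0:ℝ) < N - 2 := by linarith
  refine ⟨h, ?_, ?_, ?_⟩
  · unfold pStar; positivity
  · unfold pStar; field_simp
  · unfold pStar; ring

theorem holder {N : ℕ} (hN : 2 < N) {Ω S : Set (Euc N)} {W h u : Euc N → ℝ} (hS : MeasurableSet S) (hΩ : IsOpen Ω)
    (hSΩ : S ⊆ Ω) (hW : ContinuousOn W Ω) (hWpos : ∀ x ∈ Ω, 0 < W x)
    (hh : ∀ x ∈ Ω, 0 ≤ h x) (hhm : AEStronglyMeasurable h (volume.restrict Ω))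
    (hI : IntegrableOn (fun x => h x ^ ((N : ℝ) / 2) * W x ^ ((2 - (N : ℝ)) / 2)) S) (hu : TestFun Ω u) :
    ∫ x in S, h x * (u x * u x) ≤ (∫ x in S, h x ^ ((N : ℝ) / 2) * W x ^ ((2 - (N : ℝ)) / 2)) ^ (2 / (N:ℝ)) *
      (∫ x in Ω, W x * |u x| ^ pStar 2 N) ^ (2 / pStar 2 N) := by
  obtain ⟨h2, hp, he, hpe⟩ := pStar_val hN
  have h3 : (0:ℝ) < N - 2 := by linarith
  have hN0 : (0:ℝ) < N := by linarith
  set P : ℝ := (N:ℝ) / 2 with hP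
  set R : ℝ := (N:ℝ) / (N - 2) with hR
  have hP0 : 0 < P := by positivity
  have hR0 : 0 < R := by positivity
  have hPR : P.HolderConjugate R := by
    rw [Real.holderConjugate_iff]
    refine ⟨by rw [hP]; linarith, ?_⟩
    rw [hP, hR]; field_simp; ring
  set a : ℝ := ((N:ℝ) - 2) / N with ha
  set F : Euc N → ℝ := fun x => h x * W x ^ (-a) with hF
  set G : Euc N → ℝ := fun x => W x ^ a * (u x * u x) with hG
  have hWS : ∀ b : ℝ, ContinuousOn (fun x => W x ^ b) Ω := fun b =>
    hW.rpow_const (fun x hx => Or.inl (hWpos x hx).ne')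
  have hWm : ∀ b : ℝ, AEStronglyMeasurable (fun x => W x ^ b) (volume.restrict S) := fun b =>
    ((hWS b).aestronglyMeasurable hΩ.measurableSet).mono_measure (Measure.restrict_mono hSΩ le_rfl)
  have hFm : AEStronglyMeasurable F (volume.restrict S) :=
    (hhm.mono_measure (Measure.restrict_mono hSΩ le_rfl)).mul (hWm _)
  have hGm : AEStronglyMeasurable G (volume.restrict S) :=
    (hWm _).mul (hu.cont.mul hu.cont).aestronglyMeasurable
  have hF0 : ∀ x ∈ Ω, 0 ≤ F x := fun x hx => mul_nonneg (hh x hx) (Real.rpow_nonneg (hWpos x hx).le _)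
  have hG0 : ∀ x ∈ Ω, 0 ≤ G x := fun x hx => mul_nonneg (Real.rpow_nonneg (hWpos x hx).le _) (mul_self_nonneg _)
  have hFP : ∀ x ∈ Ω, F x ^ P = h x ^ P * W x ^ ((2 - (N:ℝ)) / 2) := fun x hx => by
    rw [hF]; simp only
    rw [Real.mul_rpow (hh x hx) (Real.rpow_nonneg (hWpos x hx).le _), ← Real.rpow_mul (hWpos x hx).le]
    congr 2
    rw [ha, hP]; field_simp; ring
  have hGR : ∀ x ∈ Ω, G x ^ R = W x * |u x| ^ pStar 2 N := fun x hx => by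
    rw [hG]; simp only
    rw [Real.mul_rpow (Real.rpow_nonneg (hWpos x hx).le _) (mul_self_nonneg _), ← Real.rpow_mul (hWpos x hx).le]
    have h1 : a * R = 1 := by rw [ha, hR]; field_simp
    rw [h1, Real.rpow_one, ← abs_mul_abs_self, ← sq, ← Real.rpow_two, ← Real.rpow_mul (abs_nonneg _), hpe]
  have haeΩ : ∀ᵐ x ∂(volume.restrict S), x ∈ Ω := by
    filter_upwards [ae_restrict_mem hS] with x hx using hSΩ hx
  have hWi := W_integrable hp hW hu
  have hGi : IntegrableOn (fun x => W x * |u x| ^ pStar 2 N) S := hWi.mono_set hSΩ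
  have hFL : MemLp F (ENNReal.ofReal P) (volume.restrict S) := by
    rw [← integrable_norm_rpow_iff hFm (by simpa using hP0) (by simp), ENNReal.toReal_ofReal hP0.le]
    refine hI.congr ?_
    filter_upwards [haeΩ] with x hx
    rw [Real.norm_of_nonneg (hF0 x hx), hFP x hx]
  have hGL : MemLp G (ENNReal.ofReal R) (volume.restrict S) := by
    rw [← integrable_norm_rpow_iff hGm (by simpa using hR0) (by simp), ENNReal.toReal_ofReal hR0.le]
    refine hGi.congr ?_
    filter_upwards [haeΩ] with x hx
    rw [Real.norm_of_nonneg (hG0 x hx), hGR x hx]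
  have key := integral_mul_le_Lp_mul_Lq_of_nonneg hPR (haeΩ.mono fun x hx => hF0 x hx) (haeΩ.mono fun x hx => hG0 x hx) hFL hGL
  have e1 : ∫ x in S, F x * G x = ∫ x in S, h x * (u x * u x) := by
    refine integral_congr_ae ?_
    filter_upwards [haeΩ] with x hx
    rw [hF, hG]; simp only
    have h1 : W x ^ (-a) * W x ^ a = 1 := by rw [← Real.rpow_add (hWpos x hx)]; simp
    calc h x * W x ^ (-a) * (W x ^ a * (u x * u x)) = (W x ^ (-a) * W x ^ a) * (h x * (u x * u x)) := by ring
      _ = _ := by rw [h1, one_mul]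
  have e2 : ∫ x in S, F x ^ P = ∫ x in S, h x ^ P * W x ^ ((2 - (N:ℝ)) / 2) := by
    refine integral_congr_ae ?_
    filter_upwards [haeΩ] with x hx using hFP x hx
  have e3 : ∫ x in S, G x ^ R = ∫ x in S, W x * |u x| ^ pStar 2 N := by
    refine integral_congr_ae ?_
    filter_upwards [haeΩ] with x hx using hGR x hx
  rw [e1, e2, e3] at key
  have e4 : 1 / P = 2 / (N:ℝ) := by rw [hP]; field_simp
  have e5 : 1 / R = 2 / pStar 2 N := by rw [he, ha, hR, one_div_div]
  rw [e4, e5] at key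
  have hWnn : ∀ x ∈ Ω, 0 ≤ W x * |u x| ^ pStar 2 N := fun x hx =>
    mul_nonneg (hWpos x hx).le (Real.rpow_nonneg (abs_nonneg _) _)
  refine key.trans (mul_le_mul_of_nonneg_left ?_ ?_)
  · refine Real.rpow_le_rpow (setIntegral_nonneg hS fun x hx => hWnn x (hSΩ hx)) ?_ (by positivity)
    exact setIntegral_mono_set hWi (by filter_upwards [ae_restrict_mem hΩ.measurableSet] with x hx using hWnn x hx)
      (HasSubset.Subset.eventuallyLE hSΩ)
  · exact Real.rpow_nonneg (setIntegral_nonneg hS fun x hx =>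
      mul_nonneg (Real.rpow_nonneg (hh x (hSΩ hx)) _) (Real.rpow_nonneg (hWpos x (hSΩ hx)).le _)) _

/-- the auxiliary weight -/
theorem aux_weight {N : ℕ} (hN : 2 < N) {Ω : Set (Euc N)} {W : Euc N → ℝ} (hΩ : IsOpen Ω)
    (hW : ContinuousOn W Ω) (hWpos : ∀ x ∈ Ω, 0 < W x) :
    ∃ m : Euc N → ℝ, ContinuousOn m Ω ∧ (∀ x ∈ Ω, 0 < m x) ∧
      ∃ A : ℝ, 0 ≤ A ∧ ∀ u, TestFun Ω u → ∫ x in Ω, m x * (u x * u x) ≤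
        A * (∫ x in Ω, W x * |u x| ^ pStar 2 N) ^ (2 / pStar 2 N) := by
  obtain ⟨h2, hp, he, hpe⟩ := pStar_val hN
  have hN0 : (0:ℝ) < N := by linarith
  set a : ℝ := ((N:ℝ) - 2) / N with ha
  have h1p : ∀ x : Euc N, 0 < 1 + ‖x‖ := fun x => by positivity
  have hmc : ContinuousOn (fun x => W x ^ a * (1 + ‖x‖) ^ (-4 : ℝ)) Ω :=
    (hW.rpow_const (fun x hx => Or.inl (hWpos x hx).ne')).mul
      ((continuous_const.add continuous_norm).rpow_const (fun x => Or.inl (h1p x).ne')).continuousOn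
  have hmp : ∀ x ∈ Ω, 0 < W x ^ a * (1 + ‖x‖) ^ (-4 : ℝ) := fun x hx =>
    mul_pos (Real.rpow_pos_of_pos (hWpos x hx) _) (Real.rpow_pos_of_pos (h1p x) _)
  refine ⟨_, hmc, hmp, _, ?_, fun u hu => holder hN hΩ.measurableSet hΩ subset_rfl hW hWpos (fun x hx => (hmp x hx).le)
    (hmc.aestronglyMeasurable hΩ.measurableSet) ?_ hu⟩
  · exact Real.rpow_nonneg (setIntegral_nonneg hΩ.measurableSet fun x hx =>
      mul_nonneg (Real.rpow_nonneg (hmp x hx).le _) (Real.rpow_nonneg (hWpos x hx).le _)) _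
  · have hi : Integrable (fun x : Euc N => (1 + ‖x‖) ^ (-(2 * N : ℝ))) := by
      refine integrable_one_add_norm ?_
      rw [finrank_euclideanSpace_fin]; linarith
    refine (hi.integrableOn (s := Ω)).congr ?_
    filter_upwards [ae_restrict_mem hΩ.measurableSet] with x hx
    rw [Real.mul_rpow (Real.rpow_nonneg (hWpos x hx).le _) (Real.rpow_nonneg (h1p x).le _),
      ← Real.rpow_mul (hWpos x hx).le, ← Real.rpow_mul (h1p x).le, mul_right_comm, ← Real.rpow_add (hWpos x hx)]
    have e1 : a * (N / 2) + (2 - (N:ℝ)) / 2 = 0 := by rw [ha]; field_simp; ring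
    have e2 : (-4 : ℝ) * (N / 2) = -(2 * N) := by ring
    rw [e1, e2, Real.rpow_zero, one_mul]

def reg (ε : ℝ) (s : ℝ) : ℝ := √(s ^ 2 + ε ^ 2) - ε

theorem reg_nonneg {ε : ℝ} (hε : 0 < ε) (s : ℝ) : 0 ≤ reg ε s := by
  unfold reg
  have : ε ≤ √(s ^ 2 + ε ^ 2) := Real.le_sqrt_of_sq_le (by nlinarith [sq_nonneg s])
  linarith

theorem reg_le {ε : ℝ} (hε : 0 < ε) (s : ℝ) : reg ε s ≤ |s| := by
  unfold reg
  have : √(s ^ 2 + ε ^ 2) ≤ |s| + ε := by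
    rw [Real.sqrt_le_left (by positivity)]
    nlinarith [sq_abs s, abs_nonneg s]
  linarith

theorem reg_zero {ε : ℝ} (hε : 0 < ε) : reg ε 0 = 0 := by
  simp [reg, Real.sqrt_sq hε.le]

theorem reg_lim (s : ℝ) : Tendsto (fun k : ℕ => reg (1 / ((k:ℝ) + 1)) s) atTop (𝓝 |s|) := by
  have h : Continuous (fun ε : ℝ => reg ε s) := by unfold reg; fun_prop
  have h1 := (h.tendsto 0).comp tendsto_one_div_add_atTop_nhds_zero_nat
  have h2 : reg 0 s = |s| := by simp [reg, Real.sqrt_sq_eq_abs]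
  rw [h2] at h1
  exact h1

theorem reg_test {N : ℕ} {Ω : Set (Euc N)} {u : Euc N → ℝ} {ε : ℝ} (hε : 0 < ε) (hu : TestFun Ω u) :
    TestFun Ω (fun x => reg ε (u x)) := by
  have hs : tsupport (fun x => reg ε (u x)) ⊆ tsupport u := by
    refine closure_mono fun x hx => ?_
    intro h0
    exact hx (by simp only [h0]; exact reg_zero hε)
  refine ⟨?_, hu.2.1.of_isClosed_subset (isClosed_tsupport _) hs, hs.trans hu.2.2⟩
  unfold reg
  refine ContDiff.sub (ContDiff.sqrt ((hu.1.pow 2).add contDiff_const) fun x => ?_) contDiff_const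
  positivity

theorem reg_grad {N : ℕ} {Ω : Set (Euc N)} {u : Euc N → ℝ} {ε : ℝ} (hε : 0 < ε) (hu : TestFun Ω u) (x : Euc N) :
    inner ℝ (gradient (fun x => reg ε (u x)) x) (gradient (fun x => reg ε (u x)) x) ≤
      inner ℝ (gradient u x) (gradient u x) := by
  have hpos : 0 < u x ^ 2 + ε ^ 2 := by positivity
  have h1 : HasFDerivAt (fun y => u y ^ 2 + ε ^ 2) ((2 * u x) • fderiv ℝ u x) x := by
    have := ((hu.diff x).hasFDerivAt.pow 2).add_const (ε ^ 2)
    simpa using this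
  have h2 : HasFDerivAt (fun x => reg ε (u x)) ((1 / (2 * √(u x ^ 2 + ε ^ 2))) • ((2 * u x) • fderiv ℝ u x)) x :=
    (h1.sqrt hpos.ne').sub_const ε
  rw [real_inner_self_eq_norm_sq, real_inner_self_eq_norm_sq]
  refine pow_le_pow_left₀ (norm_nonneg _) ?_ 2
  unfold gradient
  rw [LinearIsometryEquiv.norm_map, LinearIsometryEquiv.norm_map, h2.fderiv, smul_smul, norm_smul]
  refine mul_le_of_le_one_left (norm_nonneg _) ?_
  have hsp : 0 < √(u x ^ 2 + ε ^ 2) := Real.sqrt_pos.2 hpos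
  have h3 : |u x| ≤ √(u x ^ 2 + ε ^ 2) := Real.le_sqrt_of_sq_le (by rw [sq_abs]; nlinarith [sq_nonneg ε])
  have h4 : 1 / (2 * √(u x ^ 2 + ε ^ 2)) * (2 * u x) = u x / √(u x ^ 2 + ε ^ 2) := by field_simp
  rw [h4, Real.norm_eq_abs, abs_div, abs_of_pos hsp]
  exact (div_le_one hsp).2 h3

theorem nonneg_approx {N : ℕ} {Ω : Set (Euc N)} {U W u : Euc N → ℝ} {p q c : ℝ} (hp : 0 < p) (hq : 0 < q)
    (hΩ : IsOpen Ω)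
    (hW : ContinuousOn W Ω)
    (hU : LocBdd Ω U) (hUm : AEStronglyMeasurable U (volume.restrict Ω)) (hu : TestFun Ω u)
    (h : QB Ω U u u < c * (∫ x in Ω, W x * |u x| ^ p) ^ q) :
    ∃ w, TestFun Ω w ∧ (∀ x, 0 ≤ w x) ∧ QB Ω U w w < c * (∫ x in Ω, W x * |w x| ^ p) ^ q := by
  set e : ℕ → ℝ := fun k => 1 / ((k:ℝ) + 1) with he
  have he0 : ∀ k, 0 < e k := fun k => by positivity
  set w : ℕ → Euc N → ℝ := fun k x => reg (e k) (u x) with hw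
  have hwT : ∀ k, TestFun Ω (w k) := fun k => reg_test (he0 k) hu
  have hw0 : ∀ k x, 0 ≤ w k x := fun k x => reg_nonneg (he0 k) _
  have hwle : ∀ k x, w k x ≤ |u x| := fun k x => reg_le (he0 k) _
  have hwlim : ∀ x, Tendsto (fun k => w k x) atTop (𝓝 |u x|) := fun x => reg_lim _
  have hL1 : Tendsto (fun k => ∫ x in Ω, U x * (w k x * w k x)) atTop (𝓝 (∫ x in Ω, U x * (u x * u x))) := by
    refine tendsto_integral_of_dominated_convergence (fun x => ‖U x * (u x * u x)‖)
      (fun k => (pot_integrable hU hUm (hwT k) (hwT k).cont).1) (pot_integrable hU hUm hu hu.cont).norm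
      (fun k => Eventually.of_forall fun x => ?_) (Eventually.of_forall fun x => ?_)
    · rw [norm_mul, norm_mul, norm_mul, norm_mul, Real.norm_of_nonneg (hw0 k x)]
      exact mul_le_mul_of_nonneg_left (mul_self_le_mul_self (hw0 k x) (hwle k x)) (norm_nonneg _)
    · have := ((hwlim x).mul (hwlim x)).const_mul (U x)
      rwa [abs_mul_abs_self] at this
  have hL2 : Tendsto (fun k => ∫ x in Ω, W x * |w k x| ^ p) atTop (𝓝 (∫ x in Ω, W x * |u x| ^ p)) := by
    refine tendsto_integral_of_dominated_convergence (fun x => ‖W x * |u x| ^ p‖)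
      (fun k => (W_integrable hp hW (hwT k)).1) (W_integrable hp hW hu).norm
      (fun k => Eventually.of_forall fun x => ?_) (Eventually.of_forall fun x => ?_)
    · rw [norm_mul, norm_mul, Real.norm_of_nonneg (Real.rpow_nonneg (abs_nonneg _) _),
        Real.norm_of_nonneg (Real.rpow_nonneg (abs_nonneg _) _), abs_of_nonneg (hw0 k x)]
      exact mul_le_mul_of_nonneg_left (Real.rpow_le_rpow (hw0 k x) (hwle k x) hp.le) (norm_nonneg _)
    · have := (((hwlim x).abs).rpow_const (p := p) (Or.inr hp.le)).const_mul (W x)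
      rwa [abs_abs] at this
  have hL3 := (hL2.rpow_const (p := q) (Or.inr hq.le)).const_mul c
  have hL4 := hL1.const_add (∫ x in Ω, inner ℝ (gradient u x) (gradient u x))
  rw [← QB_eq hU hUm hu hu] at hL4
  obtain ⟨k, hk⟩ := (hL4.eventually_lt hL3 h).exists
  refine ⟨w k, hwT k, hw0 k, lt_of_le_of_lt ?_ hk⟩
  rw [QB_eq hU hUm (hwT k) (hwT k)]
  gcongr ?_ + _
  exact integral_mono (grad_inner_integrable (hwT k) (hwT k)) (grad_inner_integrable hu hu) (fun x => reg_grad (he0 k) hu x)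

theorem W_smul {N : ℕ} {Ω : Set (Euc N)} {W u : Euc N → ℝ} {p s : ℝ} (hs : 0 ≤ s) :
    ∫ x in Ω, W x * |s * u x| ^ p = s ^ p * ∫ x in Ω, W x * |u x| ^ p := by
  rw [← integral_const_mul]
  congr 1; ext x
  rw [abs_mul, abs_of_nonneg hs, Real.mul_rpow hs (abs_nonneg _)]; ring

theorem normalize_test {N : ℕ} {Ω : Set (Euc N)} {U W w : Euc N → ℝ} {p c : ℝ} (hp : 0 < p)
    (hΩ : IsOpen Ω) (hWpos : ∀ x ∈ Ω, 0 < W x)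
    (hpos : ∀ u : Euc N → ℝ, TestFun Ω u → 0 ≤ QB Ω U u u)
    (hw : TestFun Ω w) (hw0 : ∀ x, 0 ≤ w x)
    (h : QB Ω U w w < c * (∫ x in Ω, W x * |w x| ^ p) ^ (2 / p)) :
    ∃ v, TestFun Ω v ∧ (∀ x, 0 ≤ v x) ∧ QB Ω U v v < c ∧ ∫ x in Ω, W x * |v x| ^ p = 1 := by
  set I := ∫ x in Ω, W x * |w x| ^ p with hI
  have hI0 : 0 ≤ I := setIntegral_nonneg hΩ.measurableSet fun x hx =>
    mul_nonneg (hWpos x hx).le (Real.rpow_nonneg (abs_nonneg _) _)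
  have hq : 0 < 2 / p := by positivity
  have hIp : 0 < I := by
    rcases hI0.lt_or_eq with h1 | h1
    · exact h1
    · rw [← h1, Real.zero_rpow hq.ne', mul_zero] at h
      exact absurd (hpos w hw) (not_le.2 h)
  set s := I ^ (-(1 / p)) with hs
  have hs0 : 0 < s := Real.rpow_pos_of_pos hIp _
  refine ⟨fun x => s * w x, hw.const_mul s, fun x => mul_nonneg hs0.le (hw0 x), ?_, ?_⟩
  · rw [QB_smul s hw]
    have h1 : s ^ 2 * I ^ (2 / p) = 1 := by
      rw [hs, ← Real.rpow_two, ← Real.rpow_mul hI0, ← Real.rpow_add hIp]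
      have : -(1 / p) * 2 + 2 / p = 0 := by ring
      rw [this, Real.rpow_zero]
    calc s ^ 2 * QB Ω U w w < s ^ 2 * (c * I ^ (2 / p)) := mul_lt_mul_of_pos_left h (by positivity)
      _ = c * (s ^ 2 * I ^ (2 / p)) := by ring
      _ = c := by rw [h1, mul_one]
  · rw [W_smul hs0.le, ← hI, hs, ← Real.rpow_mul hI0]
    have : -(1 / p) * p = -1 := by field_simp
    rw [this, Real.rpow_neg_one, inv_mul_cancel₀ hIp.ne']

theorem tight {N : ℕ} (hN : 2 < N) {Ω : Set (Euc N)} {W Vt : Euc N → ℝ} {u : ℕ → Euc N → ℝ} (hΩ : IsOpen Ω)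
    (hW : ContinuousOn W Ω) (hWpos : ∀ x ∈ Ω, 0 < W x)
    (hVt : LocBdd Ω Vt) (hVm : AEStronglyMeasurable Vt (volume.restrict Ω))
    (hVtW : IntegrableOn (fun x => |Vt x| ^ ((N : ℝ) / 2) * W x ^ ((2 - (N : ℝ)) / 2)) Ω)
    (hu : ∀ k, TestFun Ω (u k)) (hu1 : ∀ k, ∫ x in Ω, W x * |u k x| ^ pStar 2 N = 1)
    (hK : ∀ K : Set (Euc N), IsCompact K → K ⊆ Ω → Tendsto (fun k => ∫ x in K, (u k x) ^ 2) atTop (𝓝 0)) :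
    Tendsto (fun k => ∫ x in Ω, Vt x * (u k x * u k x)) atTop (𝓝 0) := by
  obtain ⟨K, hK1, hK2, hK3, hK4⟩ := exhaustion hΩ
  have hN0 : (0:ℝ) < N := by have := (pStar_val hN).1; linarith
  set g : Euc N → ℝ := fun x => |Vt x| ^ ((N : ℝ) / 2) * W x ^ ((2 - (N : ℝ)) / 2) with hg
  have hT : Tendsto (fun n => ∫ x in Ω \ K n, g x) atTop (𝓝 (∫ x in ⋂ n, Ω \ K n, g x)) := by
    refine tendsto_setIntegral_of_antitone (fun n => hΩ.measurableSet.diff (hK1 n).measurableSet)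
      (fun a b hab => Set.diff_subset_diff_right (hK3 hab)) ⟨0, hVtW.mono_set Set.diff_subset⟩
  rw [← Set.diff_iUnion, hK4, Set.diff_self, setIntegral_empty] at hT
  have hT2 := hT.rpow_const (p := 2 / (N:ℝ)) (Or.inr (by positivity))
  rw [Real.zero_rpow (by positivity)] at hT2
  have hAm : AEStronglyMeasurable (fun x => |Vt x|) (volume.restrict Ω) := hVm.norm
  have hA : LocBdd Ω (fun x => |Vt x|) := fun L hL hLΩ => by
    obtain ⟨C, hC⟩ := hVt L hL hLΩ
    exact ⟨C, fun x hx => by rw [abs_abs]; exact hC x hx⟩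
  have hmain : Tendsto (fun k => ∫ x in Ω, |Vt x| * (u k x * u k x)) atTop (𝓝 0) := by
    rw [Metric.tendsto_atTop]
    intro ε hε
    obtain ⟨n, hn⟩ := (hT2.eventually (gt_mem_nhds (half_pos hε))).exists
    obtain ⟨C, hC⟩ := hA (K n) (hK1 n) (hK2 n)
    have h1 := (hK (K n) (hK1 n) (hK2 n)).const_mul C
    rw [mul_zero] at h1
    obtain ⟨k0, hk0⟩ := eventually_atTop.1 (h1.eventually (gt_mem_nhds (half_pos hε)))
    refine ⟨k0, fun k hk => ?_⟩
    have hi := pot_integrable hA hAm (hu k) (hu k).cont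
    rw [Real.dist_eq, sub_zero, abs_of_nonneg (integral_nonneg fun x => mul_nonneg (abs_nonneg _) (mul_self_nonneg _))]
    have hsplit : ∫ x in Ω, |Vt x| * (u k x * u k x) = (∫ x in K n, |Vt x| * (u k x * u k x)) +
        ∫ x in Ω \ K n, |Vt x| * (u k x * u k x) := by
      rw [← setIntegral_union Set.disjoint_sdiff_right (hΩ.measurableSet.diff (hK1 n).measurableSet)
        (hi.mono_set (hK2 n)) (hi.mono_set Set.diff_subset), Set.union_diff_cancel (hK2 n)]
    have h2 : ∫ x in K n, |Vt x| * (u k x * u k x) ≤ C * ∫ x in K n, (u k x) ^ 2 := by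
      rw [← integral_const_mul]
      refine setIntegral_mono_on (hi.mono_set (hK2 n))
        ((((hu k).cont.pow 2).continuousOn.integrableOn_compact (hK1 n)).const_mul C) (hK1 n).measurableSet (fun x hx => ?_)
      rw [← sq]
      exact mul_le_mul_of_nonneg_right ((le_abs_self _).trans (hC x hx)) (sq_nonneg _)
    have h3 := holder hN (S := Ω \ K n) (h := fun x => |Vt x|) (hΩ.measurableSet.diff (hK1 n).measurableSet) hΩ Set.diff_subset
      hW hWpos (fun x _ => abs_nonneg _) hAm (hVtW.mono_set Set.diff_subset) (hu k)
    rw [hu1 k, Real.one_rpow, mul_one] at h3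
    have h4 := hk0 k hk
    have h5 : (∫ x in Ω \ K n, |Vt x| * (u k x * u k x)) < ε / 2 := lt_of_le_of_lt h3 hn
    linarith
  refine squeeze_zero_norm (fun k => ?_) hmain
  refine (norm_integral_le_integral_norm _).trans_eq ?_
  congr 1; ext x
  rw [norm_mul, Real.norm_eq_abs, Real.norm_of_nonneg (mul_self_nonneg _)]

theorem gs_of_conv {N : ℕ} {Ω : Set (Euc N)} {U φ : Euc N → ℝ} {u : ℕ → Euc N → ℝ} (hΩ : IsOpen Ω)
    (hu : ∀ k, TestFun Ω (u k)) (hnn : ∀ k x, 0 ≤ u k x)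
    (hQ : Tendsto (fun k => QB Ω U (u k) (u k)) atTop (𝓝 0)) (hφ : ContDiffOn ℝ 1 φ Ω)
    (hK : ∀ K : Set (Euc N), IsCompact K → K ⊆ Ω → Tendsto (fun k => ∫ x in K, (u k x - φ x) ^ 2) atTop (𝓝 0))
    {x1 : Euc N} (hx1 : x1 ∈ Ω) (hne : φ x1 ≠ 0) : ∃ φ, IsGroundState Ω U 2 φ := by
  have hφc : ContinuousOn φ Ω := hφ.continuousOn
  obtain ⟨r, hr, hrΩ⟩ := Metric.nhds_basis_closedBall.mem_iff.1 (hΩ.mem_nhds hx1)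
  set B := Metric.ball x1 r with hB
  set D := Metric.closedBall x1 r with hD
  have hDc : IsCompact D := isCompact_closedBall x1 r
  have hBD : B ⊆ D := Metric.ball_subset_closedBall
  have hcl : closure B ⊆ D := Metric.closure_ball_subset_closedBall
  have memφ : ∀ K : Set (Euc N), IsCompact K → K ⊆ Ω → MemLp φ 2 (volume.restrict K) := fun K hKc hKΩ => by
    have h1 := (hφc.mono hKΩ)
    refine (memLp_two_iff_integrable_sq (h1.aestronglyMeasurable hKc.measurableSet)).2 ?_
    exact (h1.pow 2).integrableOn_compact hKc
  have memu : ∀ k (K : Set (Euc N)), MemLp (u k) 2 (volume.restrict K) := fun k K =>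
    ((hu k).cont.memLp_of_hasCompactSupport (hu k).2.1).mono_measure Measure.restrict_le_self
  have hrB : volume.restrict B ≤ volume.restrict D := Measure.restrict_mono hBD le_rfl
  have memφB : MemLp φ 2 (volume.restrict B) := (memφ D hDc hrΩ).mono_measure hrB
  obtain ⟨M, hM⟩ := hDc.exists_bound_of_continuousOn (hφc.mono hrΩ)
  have hM0 : 0 ≤ M := (norm_nonneg _).trans (hM x1 (Metric.mem_closedBall_self hr.le))
  set I := ∫ x in B, (φ x) ^ 2 with hI
  set J : ℕ → ℝ := fun k => ∫ x in B, (u k x) ^ 2 with hJ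
  have hIpos : 0 < I := by
    rw [hI, setIntegral_pos_iff_support_of_nonneg_ae (Eventually.of_forall fun x => sq_nonneg _) memφB.integrable_sq]
    have hop : IsOpen (B ∩ φ ⁻¹' {0}ᶜ) :=
      (hφc.mono (hBD.trans hrΩ)).isOpen_inter_preimage Metric.isOpen_ball isOpen_compl_singleton
    refine lt_of_lt_of_le (hop.measure_pos _ ⟨x1, Metric.mem_ball_self hr, hne⟩) (measure_mono ?_)
    rintro x ⟨h1, h2⟩
    exact ⟨pow_ne_zero 2 h2, h1⟩
  have hJI : Tendsto J atTop (𝓝 I) := by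
    rw [tendsto_iff_norm_sub_tendsto_zero]
    have hL1 := L1_of_L2 (g := fun k x => u k x - φ x) hDc (fun k => (memu k D).sub (memφ D hDc hrΩ)) (hK D hDc hrΩ)
    have hsum := (hK D hDc hrΩ).add (hL1.const_mul (2 * M))
    rw [mul_zero, add_zero] at hsum
    refine squeeze_zero (fun k => norm_nonneg _) (fun k => ?_) hsum
    haveI : IsFiniteMeasure (volume.restrict D) := ⟨by simpa using hDc.measure_lt_top⟩
    have hi1 : IntegrableOn (fun x => (u k x - φ x) ^ 2) D := ((memu k D).sub (memφ D hDc hrΩ)).integrable_sq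
    have hi2 : IntegrableOn (fun x => |u k x - φ x|) D := (((memu k D).sub (memφ D hDc hrΩ)).integrable (by norm_num)).abs
    rw [hJ, hI]; simp only
    rw [← integral_sub (memu k B).integrable_sq memφB.integrable_sq, ← integral_const_mul, ← integral_add hi1 (hi2.const_mul _)]
    refine (norm_integral_le_integral_norm _).trans ?_
    refine (setIntegral_mono_on ((memu k B).integrable_sq.sub memφB.integrable_sq).norm
      ((hi1.add (hi2.const_mul (2 * M))).mono_set hBD) measurableSet_ball (fun x hx => ?_)).trans
      (setIntegral_mono_set (hi1.add (hi2.const_mul (2 * M))) (Eventually.of_forall fun x => ?_) (HasSubset.Subset.eventuallyLE hBD))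
    · have e : u k x ^ 2 - φ x ^ 2 = (u k x - φ x) ^ 2 + 2 * φ x * (u k x - φ x) := by ring
      simp only [Pi.add_apply, Pi.sub_apply]
      rw [e]
      refine (norm_add_le _ _).trans ?_
      rw [Real.norm_of_nonneg (sq_nonneg _), norm_mul, norm_mul, Real.norm_ofNat]
      gcongr
      · exact hM x (hBD hx)
      · exact le_rfl
    · simp only [Pi.zero_apply, Pi.add_apply]; positivity
  obtain ⟨k0, hk0⟩ := eventually_atTop.1 (hJI.eventually (lt_mem_nhds hIpos))
  set c : ℕ → ℝ := fun k => (√(J (k + k0)))⁻¹ with hc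
  set c0 := (√I)⁻¹ with hc0
  have hshift : Tendsto (fun k : ℕ => k + k0) atTop atTop := tendsto_add_atTop_nat k0
  have hcl2 : Tendsto c atTop (𝓝 c0) := ((hJI.comp hshift).sqrt).inv₀ (Real.sqrt_pos.2 hIpos).ne'
  have hJpos : ∀ k, 0 < J (k + k0) := fun k => hk0 _ (by omega)
  refine ⟨fun x => c0 * φ x, contDiffOn_const.mul hφ, fun k x => c k * u (k + k0) x, B, Metric.isOpen_ball,
    ⟨x1, Metric.mem_ball_self hr⟩, hDc.of_isClosed_subset isClosed_closure hcl, hcl.trans hrΩ,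
    fun k => ⟨(hu _).const_mul _, fun x => mul_nonneg (by positivity) (hnn _ x)⟩, ?_, fun k => ?_, fun K hKc hKΩ => ?_⟩
  · simp only [Qfun_eq_QB]
    have : ∀ k, QB Ω U (fun x => c k * u (k + k0) x) (fun x => c k * u (k + k0) x) =
      c k ^ 2 * QB Ω U (u (k + k0)) (u (k + k0)) := fun k => QB_smul _ (hu _)
    simp only [this]
    have := (hcl2.pow 2).mul (hQ.comp hshift)
    rwa [mul_zero] at this
  · have : ∀ x, |c k * u (k + k0) x| ^ (2:ℝ) = c k ^ 2 * (u (k + k0) x) ^ 2 := fun x => by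
      rw [Real.rpow_two, sq_abs, mul_pow]
    simp only [this]
    rw [integral_const_mul, hc]; simp only
    rw [inv_pow, Real.sq_sqrt (hJpos k).le]
    exact inv_mul_cancel₀ (hJpos k).ne'
  · have hlim : Tendsto (fun k => 2 * c k ^ 2 * (∫ x in K, (u (k + k0) x - φ x) ^ 2) + 2 * (c k - c0) ^ 2 * ∫ x in K, (φ x) ^ 2) atTop (𝓝 0) := by
      have h1 := ((hcl2.pow 2).const_mul 2).mul ((hK K hKc hKΩ).comp hshift)
      have h2 := (((hcl2.sub_const c0).pow 2).const_mul 2).mul_const (∫ x in K, (φ x) ^ 2)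
      have h3 := h1.add h2
      simpa using h3
    refine squeeze_zero (fun k => integral_nonneg fun x => by positivity) (fun k => ?_) hlim
    have m1 : IntegrableOn (fun x => (u (k + k0) x - φ x) ^ 2) K := ((memu (k + k0) K).sub (memφ K hKc hKΩ)).integrable_sq
    have m2 : IntegrableOn (fun x => φ x ^ 2) K := (memφ K hKc hKΩ).integrable_sq
    have m3 : IntegrableOn (fun x => (c k * u (k + k0) x - c0 * φ x) ^ 2) K := (((memu (k + k0) K).const_mul (c k)).sub ((memφ K hKc hKΩ).const_mul c0)).integrable_sq
    rw [← integral_const_mul, ← integral_const_mul, ← integral_add (m1.const_mul _) (m2.const_mul _)]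
    simp only [Real.rpow_two, sq_abs]
    refine integral_mono m3 ((m1.const_mul _).add (m2.const_mul _)) (fun x => ?_)
    simp only [Pi.add_apply, Pi.sub_apply]
    nlinarith [sq_nonneg (c k * (u (k + k0) x - φ x) - (c k - c0) * φ x)]

/-- Theorem 2.7 (i): if `Q` satisfies the HSM inequality with a positive
continuous weight `W`, `Ṽ` is a nonzero potential with `|Ṽ|^{N/2} W^{(2-N)/2} ∈ L¹(Ω)`,
and the functional `Q̃_λ = Q + λ∫ Ṽ|u|²` is nonnegative and admits no ground state, then
`Q̃_λ(u) ≥ C (∫_Ω W|u|^{2*} dx)^{2/2*}` on `C_0^∞(Ω)` for some `C > 0`. -/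
theorem statement_3 {N : ℕ} (hN : 2 < N) (Ω : Set (Euc N)) (hΩo : IsOpen Ω)
    (hΩc : IsConnected Ω) (V : Euc N → ℝ) (hV : LocBdd Ω V)
    (W : Euc N → ℝ) (hWc : ContinuousOn W Ω) (hWpos : ∀ x ∈ Ω, 0 < W x)
    (hHSM : ∀ u : Euc N → ℝ, TestFun Ω u →
      (∫ x in Ω, W x * |u x| ^ pStar 2 N) ^ (2 / pStar 2 N) ≤ Qfun Ω V 2 u)
    (Vt : Euc N → ℝ) (hVt : LocBdd Ω Vt)
    (hVtne : ¬ (∀ᵐ x ∂(volume.restrict Ω), Vt x = 0))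
    (hVtW : IntegrableOn (fun x => |Vt x| ^ ((N : ℝ) / 2) * W x ^ ((2 - (N : ℝ)) / 2)) Ω)
    (lam : ℝ)
    (hnonneg : ∀ u : Euc N → ℝ, TestFun Ω u → 0 ≤ Qfun Ω (fun x => V x + lam * Vt x) 2 u)
    (hnogs : ¬ ∃ φ : Euc N → ℝ, IsGroundState Ω (fun x => V x + lam * Vt x) 2 φ) :
    ∃ C : ℝ, 0 < C ∧ ∀ u : Euc N → ℝ, TestFun Ω u →
      C * (∫ x in Ω, W x * |u x| ^ pStar 2 N) ^ (2 / pStar 2 N) ≤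
        Qfun Ω (fun x => V x + lam * Vt x) 2 u := by
  obtain ⟨h2N, hp, he, hpe⟩ := pStar_val hN
  set p := pStar 2 N with hpdef
  have hq : 0 < 2 / p := by positivity
  by_cases hlam : lam = 0
  · refine ⟨1, one_pos, fun u hu => ?_⟩
    rw [one_mul]
    simpa [hlam] using hHSM u hu
  set U : Euc N → ℝ := fun x => V x + lam * Vt x with hUdef
  have hVm : AEStronglyMeasurable V (volume.restrict Ω) := meas_of_HSM hp hΩo hWc hWpos hHSM
  have hUm : AEStronglyMeasurable U (volume.restrict Ω) := meas_of_nogs hΩo hnogs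
  have hVtm : AEStronglyMeasurable Vt (volume.restrict Ω) := by
    refine ((hUm.sub hVm).const_mul lam⁻¹).congr (Eventually.of_forall fun x => ?_)
    simp [hUdef, hlam]
  have hU : LocBdd Ω U := fun K hK hKΩ => by
    obtain ⟨C1, h1⟩ := hV K hK hKΩ
    obtain ⟨C2, h2⟩ := hVt K hK hKΩ
    refine ⟨C1 + |lam| * C2, fun x hx => (abs_add_le _ _).trans ?_⟩
    rw [abs_mul]
    exact add_le_add (h1 x hx) (mul_le_mul_of_nonneg_left (h2 x hx) (abs_nonneg _))
  have hpos : ∀ u : Euc N → ℝ, TestFun Ω u → 0 ≤ QB Ω U u u := fun u hu => by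
    have := hnonneg u hu
    rwa [Qfun_eq_QB] at this
  by_contra hcon
  push Not at hcon
  have hex : ∀ k : ℕ, ∃ v, TestFun Ω v ∧ (∀ x, 0 ≤ v x) ∧ QB Ω U v v < 1 / ((k:ℝ) + 1) ∧
      ∫ x in Ω, W x * |v x| ^ p = 1 := by
    intro k
    obtain ⟨u, hu, hlt⟩ := hcon (1 / ((k:ℝ) + 1)) (by positivity)
    rw [Qfun_eq_QB] at hlt
    obtain ⟨w, hw, hw0, hw1⟩ := nonneg_approx hp hq hΩo hWc hU hUm hu hlt
    exact normalize_test hp hΩo hWpos hpos hw hw0 hw1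
  choose u hu hunn huQ hu1 using hex
  have hQ : Tendsto (fun k => QB Ω U (u k) (u k)) atTop (𝓝 0) :=
    squeeze_zero (fun k => hpos _ (hu k)) (fun k => (huQ k).le) tendsto_one_div_add_atTop_nhds_zero_nat
  obtain ⟨m, hm, hmpos, A, hA, hmA⟩ := aux_weight hN hΩo hWc hWpos
  have hA' : ∀ k, ∫ x in Ω, m x * (u k x * u k x) ≤ A := fun k => by
    have := hmA (u k) (hu k)
    rwa [hu1 k, Real.one_rpow, mul_one] at this
  obtain ⟨n, hn, φ, hφ, hconv⟩ := core hΩo hU hUm hpos hm hmpos hu hunn hA' hQ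
  have hQn := hQ.comp hn.tendsto_atTop
  by_cases hz : ∃ x1 ∈ Ω, φ x1 ≠ 0
  · obtain ⟨x1, hx1, hne⟩ := hz
    exact hnogs (gs_of_conv (u := fun k => u (n k)) hΩo (fun k => hu _) (fun k => hunn _) hQn hφ hconv hx1 hne)
  · push Not at hz
    have hconv0 : ∀ K : Set (Euc N), IsCompact K → K ⊆ Ω → Tendsto (fun k => ∫ x in K, (u (n k) x) ^ 2) atTop (𝓝 0) := by
      intro K hK hKΩ
      refine (hconv K hK hKΩ).congr fun k => ?_
      refine setIntegral_congr_fun hK.measurableSet fun x hx => ?_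
      simp only [hz x (hKΩ hx), sub_zero]
    have ht := tight hN (u := fun k => u (n k)) hΩo hWc hWpos hVt hVtm hVtW (fun k => hu _) (fun k => hu1 _) hconv0
    have hQV : ∀ k, QB Ω V (u k) (u k) = QB Ω U (u k) (u k) - lam * ∫ x in Ω, Vt x * (u k x * u k x) := fun k => by
      rw [QB_eq hV hVm (hu k) (hu k), QB_eq hU hUm (hu k) (hu k), add_sub_assoc, ← integral_const_mul,
        ← integral_sub (pot_integrable hU hUm (hu k) (hu k).cont) ((pot_integrable hVt hVtm (hu k) (hu k).cont).const_mul lam)]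
      congr 2; ext x
      simp only [hUdef]; ring
    have hl : Tendsto (fun k => QB Ω V (u (n k)) (u (n k))) atTop (𝓝 0) := by
      simp only [hQV]
      have := hQn.sub (ht.const_mul lam)
      rwa [mul_zero, sub_zero] at this
    have hge : ∀ k, 1 ≤ QB Ω V (u (n k)) (u (n k)) := fun k => by
      have := hHSM (u (n k)) (hu _)
      rwa [hu1, Real.one_rpow, Qfun_eq_QB] at this
    have := ge_of_tendsto' hl hge
    norm_num at this
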